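/- Let α ≥ 0 be a real number. There exists an (effectively computable) positive integer N_T(α) such that for all integers n ≥ N_T(α), the cubic Jensen polynomial J(x) = Σ_{j=0}^{3} binom(3,j)·r_α(n−1+j)·x^j has three distinct roots in ℂ, exactly one of which is real and the other two are non-real complex conjugates. -/

import Mathlib

open Real

/-- The overpartition function. -/
noncomputable def pbar (n : ℕ) : ℕ :=
  ∑ k ∈ Finset.range (n + 1),
    (Nat.Partition.distincts k).card * Fintype.card (Nat.Partition (n - k))

/-- `r_α(n) = (p̄(n)/n^α)^(1/n)`. -/
noncomputable def rseq (α : ℝ) (n : ℕ) : ℝ :=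
  ((pbar n : ℝ) / (n : ℝ) ^ α) ^ ((n : ℝ)⁻¹)

/-- The cubic Jensen polynomial `J^{3,n-1}_{r_α}` as a function on `ℂ`. -/
noncomputable def jensenCubic (α : ℝ) (n : ℕ) (x : ℂ) : ℂ :=
  ∑ j ∈ Finset.range 4, (Nat.choose 3 j : ℂ) * ((rseq α (n - 1 + j) : ℝ) : ℂ) * x ^ j

theorem exists_root_of_cubic {a b c d : ℝ} (ha : 0 < a) :
    ∃ x : ℝ, a * x ^ 3 + b * x ^ 2 + c * x + d = 0 := by
  set M : ℝ := 1 + (|b| + |c| + |d|) / a with hM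
  have hS : 0 ≤ (|b| + |c| + |d|) / a := by positivity
  have hM1 : 1 ≤ M := by linarith
  have haM : a * M = a + (|b| + |c| + |d|) := by rw [hM]; field_simp
  have hM2 : M ≤ M ^ 2 := by nlinarith
  have hM0 : 1 ≤ M ^ 2 := by nlinarith
  have hkey : a * M ^ 3 = a * M ^ 2 + (|b| + |c| + |d|) * M ^ 2 := by
    rw [show a * M ^ 3 = (a * M) * M ^ 2 by ring, haM]; ring
  have hb := abs_le.1 (le_refl |b|)
  have hc := abs_le.1 (le_refl |c|)
  have hd := abs_le.1 (le_refl |d|)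
  have h1 : |c| * M ≤ |c| * M ^ 2 := by gcongr
  have h2 : |d| ≤ |d| * M ^ 2 := le_mul_of_one_le_right (abs_nonneg _) hM0
  have hneg : a * (-M) ^ 3 + b * (-M) ^ 2 + c * (-M) + d ≤ 0 := by
    have : b * M ^ 2 ≤ |b| * M ^ 2 := by gcongr; exact hb.2
    have : -(c * M) ≤ |c| * M := by nlinarith
    nlinarith
  have hpos : 0 ≤ a * M ^ 3 + b * M ^ 2 + c * M + d := by
    have : -(b * M ^ 2) ≤ |b| * M ^ 2 := by nlinarith
    have : -(c * M) ≤ |c| * M := by nlinarith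
    nlinarith
  have hcont : ContinuousOn (fun x : ℝ => a * x ^ 3 + b * x ^ 2 + c * x + d) (Set.Icc (-M) M) := by
    fun_prop
  obtain ⟨x, -, hx⟩ := intermediate_value_Icc (by linarith) hcont ⟨hneg, hpos⟩
  exact ⟨x, hx⟩

theorem cubic_roots_of_discr_neg {a₀ a₁ a₂ a₃ : ℝ} (h3 : 0 < a₃)
    (hD : 4 * (a₁ ^ 2 - a₀ * a₂) * (a₂ ^ 2 - a₁ * a₃) < (a₁ * a₂ - a₀ * a₃) ^ 2) :
    ∃ (x : ℝ) (z : ℂ), z.im ≠ 0 ∧ ∀ w : ℂ,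
      (a₀ : ℂ) + 3 * a₁ * w + 3 * a₂ * w ^ 2 + a₃ * w ^ 3 = 0 ↔
        (w = (x : ℂ) ∨ w = z ∨ w = (starRingEnd ℂ) z) := by
  obtain ⟨x, hx⟩ := exists_root_of_cubic (b := 3 * a₂) (c := 3 * a₁) (d := a₀) h3
  set p : ℝ := (3 * a₂ + a₃ * x) / a₃ with hp
  set q : ℝ := (3 * a₁ + a₃ * p * x) / a₃ with hq
  have e2 : 3 * a₂ = a₃ * (p - x) := by rw [hp]; field_simp; ring
  have e1 : 3 * a₁ = a₃ * (q - p * x) := by rw [hq]; field_simp; ring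
  have e0 : a₀ = - a₃ * (q * x) := by
    have : a₀ = -(a₃ * x ^ 3 + 3 * a₂ * x ^ 2 + 3 * a₁ * x) := by linarith
    rw [this, e2, e1]; ring
  have hdisc : p ^ 2 - 4 * q < 0 := by
    by_contra! hcon
    have e2' : a₂ = a₃ * (p - x) / 3 := by linarith
    have e1' : a₁ = a₃ * (q - p * x) / 3 := by linarith
    have key : 27 * (4 * (a₁ ^ 2 - a₀ * a₂) * (a₂ ^ 2 - a₁ * a₃) - (a₁ * a₂ - a₀ * a₃) ^ 2)
        = a₃ ^ 4 * ((p ^ 2 - 4 * q) * (x ^ 2 + p * x + q) ^ 2) := by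
      rw [e2', e1', e0]; ring
    have : 0 ≤ a₃ ^ 4 * ((p ^ 2 - 4 * q) * (x ^ 2 + p * x + q) ^ 2) := by positivity
    linarith
  set s : ℝ := Real.sqrt (4 * q - p ^ 2) with hs
  have hspos : 0 < s := Real.sqrt_pos.2 (by linarith)
  have hs2 : s ^ 2 = 4 * q - p ^ 2 := Real.sq_sqrt (by linarith)
  refine ⟨x, ⟨-p / 2, s / 2⟩, by simpa using hspos.ne', fun w => ?_⟩
  set z : ℂ := ⟨-p / 2, s / 2⟩ with hz
  have hz1 : z + (starRingEnd ℂ) z = -p := by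
    apply Complex.ext <;> simp [hz]
  have hz2 : z * (starRingEnd ℂ) z = q := by
    apply Complex.ext <;> simp [hz] <;> nlinarith
  have hfac : (a₀ : ℂ) + 3 * a₁ * w + 3 * a₂ * w ^ 2 + a₃ * w ^ 3
      = a₃ * ((w - x) * ((w - z) * (w - (starRingEnd ℂ) z))) := by
    have e2c : (3 : ℂ) * a₂ = a₃ * (p - x) := by exact_mod_cast e2
    have e1c : (3 : ℂ) * a₁ = a₃ * (q - p * x) := by exact_mod_cast e1
    have e0c : (a₀ : ℂ) = - a₃ * (q * x) := by exact_mod_cast e0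
    have : (w - z) * (w - (starRingEnd ℂ) z) = w ^ 2 + p * w + q := by
      rw [← hz2]; linear_combination (-w) * hz1
    rw [this, e2c, e1c, e0c]; ring
  have h3c : (a₃ : ℂ) ≠ 0 := by exact_mod_cast h3.ne'
  rw [hfac]
  simp [h3c, sub_eq_zero]
/-- `f` is given on the open unit disc by the power series `a`. -/
def HasGenFun (a : PowerSeries ℂ) (f : ℂ → ℂ) : Prop :=
  ∀ q : ℂ, ‖q‖ < 1 → HasSum (fun n => PowerSeries.coeff n a * q ^ n) (f q)

theorem HasGenFun.mul {a b : PowerSeries ℂ} {f g : ℂ → ℂ} (hf : HasGenFun a f)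
    (hg : HasGenFun b g) : HasGenFun (a * b) (fun q => f q * g q) := by
  intro q hq
  have h1 := (hf q hq).summable.norm
  have h2 := (hg q hq).summable.norm
  have h := (summable_norm_sum_mul_antidiagonal_of_summable_norm h1 h2).of_norm.hasSum
  rw [← tsum_mul_tsum_eq_tsum_sum_antidiagonal_of_summable_norm h1 h2, (hf q hq).tsum_eq,
    (hg q hq).tsum_eq] at h
  refine h.congr_fun fun n => ?_
  rw [PowerSeries.coeff_mul, Finset.sum_mul]
  refine Finset.sum_congr rfl fun p hp => ?_
  rw [← Finset.HasAntidiagonal.mem_antidiagonal.1 hp, pow_add]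
  ring

theorem DifferentiableOn.hasGenFun {f : ℂ → ℂ} (hf : DifferentiableOn ℂ f (Metric.ball 0 1)) :
    HasGenFun (PowerSeries.mk fun n => ((n.factorial : ℂ)⁻¹ * iteratedDeriv n f 0)) f := by
  intro q hq
  have := Complex.hasSum_taylorSeries_on_ball (r := 1) (by simpa using hf)
    (z := q) (by simpa using hq)
  refine this.congr_fun fun n => ?_
  simp
  ring

theorem HasGenFun.coeff_eq {a : PowerSeries ℂ} {f : ℂ → ℂ} (h : HasGenFun a f) (n : ℕ) :
    PowerSeries.coeff n a = (n.factorial : ℂ)⁻¹ * iteratedDeriv n f 0 := by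
  have hp : HasFPowerSeriesOnBall f (FormalMultilinearSeries.ofScalars ℂ
      (fun n => PowerSeries.coeff n a)) 0 1 := by
    refine ⟨?_, by simp, fun {y} hy => ?_⟩
    · refine ENNReal.le_of_forall_nnreal_lt fun r hr => ?_
      refine FormalMultilinearSeries.le_radius_of_tendsto _ (l := 0) ?_
      have := (h (r : ℂ) (by simpa using hr)).summable.norm.tendsto_atTop_zero
      refine this.congr fun n => ?_
      simp
    · have := h y (by simpa [mem_eball_zero_iff, enorm_eq_nnnorm, ← NNReal.coe_lt_coe] using hy)
      simpa [FormalMultilinearSeries.ofScalars_apply_eq, smul_eq_mul, mul_comm] using this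
  have h1 := hp.hasFPowerSeriesAt.eq_formalMultilinearSeries
    hp.analyticAt.hasFPowerSeriesAt
  have h2 := congrArg (fun p => FormalMultilinearSeries.coeff p n) h1
  simp [FormalMultilinearSeries.coeff_ofScalars] at h2
  rw [h2]
  ring

theorem HasGenFun.unique {a b : PowerSeries ℂ} {f : ℂ → ℂ} (ha : HasGenFun a f)
    (hb : HasGenFun b f) : a = b := by
  ext n
  rw [ha.coeff_eq, hb.coeff_eq]

theorem tendsto_iteratedDeriv_of_tendstoLocallyUniformlyOn {ι : Type*} {l : Filter ι} [l.NeBot]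
    {F : ι → ℂ → ℂ} {f : ℂ → ℂ} {U : Set ℂ} (hU : IsOpen U)
    (hF : TendstoLocallyUniformlyOn F f l U) (hd : ∀ i, DifferentiableOn ℂ (F i) U) (n : ℕ) :
    TendstoLocallyUniformlyOn (fun i => iteratedDeriv n (F i)) (iteratedDeriv n f) l U ∧
      ∀ i, DifferentiableOn ℂ (iteratedDeriv n (F i)) U := by
  induction n with
  | zero => simpa using ⟨hF, hd⟩
  | succ n ih =>
    simp only [iteratedDeriv_succ]
    exact ⟨ih.1.deriv (.of_forall ih.2) hU, fun i => (ih.2 i).deriv hU⟩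

open PowerSeries.WithPiTopology in
theorem HasGenFun.of_hasProd {u : ℕ → ℂ → ℂ} {U : ℕ → PowerSeries ℂ} {Φ : PowerSeries ℂ}
    (hu : ∀ k, HasGenFun (U k) (u k))
    (hd : ∀ k, DifferentiableOn ℂ (u k) (Metric.ball 0 1))
    (hm : MultipliableLocallyUniformlyOn u (Metric.ball 0 1))
    (hΦ : HasProd U Φ) : HasGenFun Φ (fun q => ∏' k, u k q) := by
  have hp := hm.hasProdLocallyUniformlyOn
  have hone : HasGenFun 1 (fun _ => 1) := by
    intro q hq
    have := hasSum_single (f := fun n => PowerSeries.coeff n (1 : PowerSeries ℂ) * q ^ n) 0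
      (fun n hn => by simp [PowerSeries.coeff_one, hn])
    simpa using this
  have hfin : ∀ s : Finset ℕ, HasGenFun (∏ k ∈ s, U k) (fun q => ∏ k ∈ s, u k q) := by
    intro s
    induction s using Finset.cons_induction with
    | empty => simpa using hone
    | cons k s hk ih => simpa only [Finset.prod_cons] using (hu k).mul ih
  have hdf : ∀ s : Finset ℕ, DifferentiableOn ℂ (fun q => ∏ k ∈ s, u k q) (Metric.ball 0 1) :=
    fun s => DifferentiableOn.fun_finsetProd fun k _ => hd k
  have htend : TendstoLocallyUniformlyOn (fun (s : Finset ℕ) q => ∏ k ∈ s, u k q)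
      (fun q => ∏' k, u k q) Filter.atTop (Metric.ball 0 1) := hp
  have hdiff : DifferentiableOn ℂ (fun q => ∏' k, u k q) (Metric.ball 0 1) :=
    htend.differentiableOn (.of_forall hdf) Metric.isOpen_ball
  have hT := hdiff.hasGenFun
  convert hT using 1
  ext n
  rw [PowerSeries.coeff_mk]
  have h1 : Filter.Tendsto (fun s : Finset ℕ => PowerSeries.coeff n (∏ k ∈ s, U k)) Filter.atTop
      (nhds (PowerSeries.coeff n Φ)) :=
    (tendsto_iff_coeff_tendsto ℂ (fun s : Finset ℕ => ∏ k ∈ s, U k) _ _).1 hΦ n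
  refine tendsto_nhds_unique h1 ?_
  have h2 := ((tendsto_iteratedDeriv_of_tendstoLocallyUniformlyOn Metric.isOpen_ball htend
    hdf n).1.tendsto_at (Metric.mem_ball_self one_pos)).const_mul ((n.factorial : ℂ)⁻¹)
  exact h2.congr fun s => ((hfin s).coeff_eq n).symm

/-- Euler's function `∏ (1 - q ^ (n + 1))`. -/
noncomputable def eulerPhi (q : ℂ) : ℂ := ∏' n : ℕ, (1 - q ^ (n + 1))

theorem hasGenFun_one_sub_pow (m : ℕ) (hm : m ≠ 0) :
    HasGenFun (1 - PowerSeries.X ^ m) (fun q => 1 - q ^ m) := by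
  intro q hq
  have := hasSum_sum_of_ne_finset_zero (L := .unconditional ℕ) (s := {0, m})
    (f := fun n => PowerSeries.coeff n (1 - PowerSeries.X ^ m : PowerSeries ℂ) * q ^ n)
    (fun n hn => by
      simp only [Finset.mem_insert, Finset.mem_singleton, not_or] at hn
      simp [PowerSeries.coeff_one, PowerSeries.coeff_X_pow, hn.1, hn.2])
  convert this using 1
  rw [Finset.sum_pair hm.symm]
  simp [PowerSeries.coeff_one, PowerSeries.coeff_X_pow, hm]
  ring

theorem eulerPhi_ne_zero {q : ℂ} (hq : ‖q‖ < 1) : eulerPhi q ≠ 0 := by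
  unfold eulerPhi
  simp_rw [sub_eq_add_neg]
  refine tprod_one_add_ne_zero_of_summable (f := fun n : ℕ => -q ^ (n + 1)) (fun n => ?_) ?_
  · rw [← sub_eq_add_neg, sub_ne_zero]
    intro h
    have := congrArg norm h
    rw [norm_one, norm_pow] at this
    exact absurd this.symm (pow_lt_one₀ (norm_nonneg _) hq (by simp)).ne
  · simpa using (summable_nat_add_iff 1).mpr (summable_geometric_of_lt_one (norm_nonneg _) hq)

theorem differentiableOn_eulerPhi : DifferentiableOn ℂ eulerPhi (Metric.ball 0 1) :=
  ModularForm.differentiableOn_tprod_one_sub_pow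

/-- The generating function of overpartitions. -/
noncomputable def overGen (q : ℂ) : ℂ := eulerPhi (q ^ 2) / eulerPhi q ^ 2

theorem differentiableOn_overGen : DifferentiableOn ℂ overGen (Metric.ball 0 1) := by
  refine DifferentiableOn.div ?_ (differentiableOn_eulerPhi.pow 2)
    fun q hq => pow_ne_zero 2 (eulerPhi_ne_zero (by simpa using hq))
  refine differentiableOn_eulerPhi.comp (by fun_prop) fun q hq => ?_
  simp only [Metric.mem_ball, dist_zero_right, norm_pow] at hq ⊢
  exact pow_lt_one₀ (norm_nonneg _) hq two_ne_zero

open PowerSeries PowerSeries.WithPiTopology in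
theorem hasSum_pbar {q : ℂ} (hq : ‖q‖ < 1) :
    HasSum (fun n => (pbar n : ℂ) * q ^ n) (overGen q) := by
  have h1 : HasProd (fun n : ℕ => (1 - X ^ (n + 1) : ℂ⟦X⟧)) (pentagonalSeries ℂ) :=
    hasProd_one_sub_X_pow ℂ
  have hd : HasProd (fun n : ℕ => (1 + X ^ (n + 1) : ℂ⟦X⟧))
      (PowerSeries.mk fun n => ((Nat.Partition.distincts n).card : ℂ)) := by
    have := Nat.Partition.hasProd_powerSeriesMk_card_countRestricted ℂ (m := 2) two_pos
    simpa [Finset.sum_range_succ, Nat.Partition.countRestricted_two] using this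
  have hp : HasProd (fun n : ℕ => (∑' j : ℕ, X ^ ((n + 1) * j) : ℂ⟦X⟧))
      (PowerSeries.mk fun n => (Fintype.card (Nat.Partition n) : ℂ)) := by
    have := Nat.Partition.hasProd_powerSeriesMk_card_restricted ℂ (fun _ => True)
    simpa [Nat.Partition.restricted] using this
  have hprod : (PowerSeries.mk fun n => (Fintype.card (Nat.Partition n) : ℂ)) *
      pentagonalSeries ℂ = 1 := by
    refine (hp.mul h1).unique ?_
    convert hasProd_one with n
    simp_rw [pow_mul]
    exact tsum_pow_mul_one_sub_of_constantCoeff_eq_zero (by simp)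
  set D := (PowerSeries.mk fun n => ((Nat.Partition.distincts n).card : ℂ))
  set P := (PowerSeries.mk fun n => (Fintype.card (Nat.Partition n) : ℂ))
  have h2 : HasProd (fun n : ℕ => (1 - X ^ (2 * (n + 1)) : ℂ⟦X⟧)) (D * pentagonalSeries ℂ) := by
    convert hd.mul h1 using 2 with n
    ring
  have g1 : HasGenFun (pentagonalSeries ℂ) eulerPhi :=
    HasGenFun.of_hasProd (fun k => hasGenFun_one_sub_pow (k + 1) (by simp))
      (fun k => by fun_prop) ModularForm.multipliableLocallyUniformlyOn_one_sub_pow h1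
  have g2 : HasGenFun (D * pentagonalSeries ℂ) (fun q => eulerPhi (q ^ 2)) := by
    have := HasGenFun.of_hasProd (fun k => hasGenFun_one_sub_pow (2 * (k + 1)) (by simp))
      (fun k => by fun_prop) ?_ h2
    · simpa [eulerPhi, pow_mul] using this
    · simp_rw [pow_mul]
      refine ModularForm.multipliableLocallyUniformlyOn_one_sub_pow.comp (fun q => q ^ 2)
        (fun q hq => ?_) (by fun_prop)
      simp only [Metric.mem_ball, dist_zero_right, norm_pow] at hq ⊢
      exact pow_lt_one₀ (norm_nonneg _) hq two_ne_zero
  have g3 := differentiableOn_overGen.hasGenFun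
  have g4 := g3.mul (g1.mul g1)
  have g5 : HasGenFun (D * pentagonalSeries ℂ)
      (fun q => overGen q * (eulerPhi q * eulerPhi q)) := by
    intro q hq
    have := g2 q hq
    convert this using 1
    have := eulerPhi_ne_zero hq
    unfold overGen
    field_simp
  have g6 := g4.unique g5
  have g7 : (PowerSeries.mk fun n => ((n.factorial : ℂ)⁻¹ * iteratedDeriv n overGen 0)) =
      D * P := by
    set T := (PowerSeries.mk fun n => ((n.factorial : ℂ)⁻¹ * iteratedDeriv n overGen 0))
    calc T = T * (pentagonalSeries ℂ * pentagonalSeries ℂ) * (P * P) := by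
          rw [mul_assoc, show pentagonalSeries ℂ * pentagonalSeries ℂ * (P * P)
            = (P * pentagonalSeries ℂ) * (P * pentagonalSeries ℂ) by ring, hprod]; simp
      _ = D * P * (P * pentagonalSeries ℂ) := by rw [g6]; ring
      _ = _ := by rw [hprod, mul_one]
  rw [g7] at g3
  refine (g3 q hq).congr_fun fun n => ?_
  congr 1
  rw [PowerSeries.coeff_mul, Finset.Nat.sum_antidiagonal_eq_sum_range_succ_mk]
  simp [pbar, D, P]

theorem norm_sub_shift_le_of_ball {f : ℂ → ℂ} {x : ℂ} {R B : ℝ} (hR : 2 < R)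
    (hf : DifferentiableOn ℂ f (Metric.ball x R)) (hB : ∀ z ∈ Metric.ball x R, ‖f z‖ ≤ B) :
    DifferentiableOn ℂ (fun z => f (z + 1) - f z) (Metric.ball x (R / 2)) ∧
      ∀ z ∈ Metric.ball x (R / 2), ‖f (z + 1) - f z‖ ≤ 4 * B / R := by
  have hsub : Metric.ball x (R / 2) ⊆ Metric.ball x R := Metric.ball_subset_ball (by linarith)
  have hball : ∀ z ∈ Metric.ball x (R / 2), Metric.ball z (R / 2) ⊆ Metric.ball x R := by
    intro z hz
    refine Metric.ball_subset_ball' ?_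
    rw [Metric.mem_ball] at hz
    linarith
  have hone : ∀ z : ℂ, z + 1 ∈ Metric.ball z (R / 2) := by
    intro z
    simp only [Metric.mem_ball, dist_self_add_left, norm_one]
    linarith
  refine ⟨?_, fun z hz => ?_⟩
  · refine DifferentiableOn.sub ?_ (hf.mono hsub)
    exact hf.comp (by fun_prop) fun z hz => hball z hz (hone z)
  · have h := Complex.dist_le_div_mul_dist_of_mapsTo_ball (R₂ := 2 * B) (hf.mono (hball z hz))
      (fun w hw => ?_) (hone z)
    · rw [dist_eq_norm] at h
      refine h.trans (le_of_eq ?_)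
      simp only [dist_self_add_left, norm_one]
      field_simp
      ring
    · rw [mem_closedBall_iff_norm]
      have h1 := hB w (hball z hz hw)
      have h2 := hB z (hsub hz)
      exact (norm_sub_le _ _).trans (by linarith)

theorem norm_differences_le_of_ball {f : ℂ → ℂ} {x : ℂ} {R B : ℝ} (hR : 8 < R)
    (hf : DifferentiableOn ℂ f (Metric.ball x R)) (hB : ∀ z ∈ Metric.ball x R, ‖f z‖ ≤ B) :
    ‖f (x + 1) - f x‖ ≤ 4 * B / R ∧
    ‖f (x + 2) - 2 * f (x + 1) + f x‖ ≤ 32 * B / R ^ 2 ∧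
    ‖f (x + 3) - 3 * f (x + 2) + 3 * f (x + 1) - f x‖ ≤ 512 * B / R ^ 3 := by
  obtain ⟨d1, b1⟩ := norm_sub_shift_le_of_ball (by linarith) hf hB
  obtain ⟨d2, b2⟩ := norm_sub_shift_le_of_ball (by linarith) d1 b1
  obtain ⟨d3, b3⟩ := norm_sub_shift_le_of_ball (by linarith) d2 b2
  have e2 : x + 1 + 1 = x + 2 := by ring
  have e3 : x + 2 + 1 = x + 3 := by ring
  refine ⟨b1 x (Metric.mem_ball_self (by linarith)), ?_, ?_⟩
  · convert b2 x (Metric.mem_ball_self (by linarith)) using 1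
    · rw [e2]; ring_nf
    · field_simp; ring
  · convert b3 x (Metric.mem_ball_self (by linarith)) using 1
    · rw [e2, e3]; ring_nf
    · field_simp; ring

theorem sub_le_of_hasDerivAt_le {f f' : ℝ → ℝ} {x C : ℝ}
    (hf : ∀ y ∈ Set.Icc x (x + 1), HasDerivAt f (f' y) y)
    (hC : ∀ y ∈ Set.Icc x (x + 1), f' y ≤ C) : f (x + 1) - f x ≤ C := by
  have h_int : ∀ y ∈ interior (Set.Icc x (x + 1)), y ∈ Set.Icc x (x + 1) :=
    fun y hy => interior_subset hy
  have := (convex_Icc x (x + 1)).image_sub_le_mul_sub_of_deriv_le (f := f) (C := C)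
    (fun y hy => (hf y hy).continuousAt.continuousWithinAt)
    (fun y hy => (hf y (h_int y hy)).differentiableAt.differentiableWithinAt)
    (fun y hy => by rw [(hf y (h_int y hy)).deriv]; exact hC y (h_int y hy))
    x (by simp) (x + 1) (by simp) (by linarith)
  simpa using this

theorem third_difference_rpow_neg_half_le {x : ℝ} (hx : 0 < x) :
    (x + 3) ^ (-(1 / 2) : ℝ) - 3 * (x + 2) ^ (-(1 / 2) : ℝ) + 3 * (x + 1) ^ (-(1 / 2) : ℝ)
      - x ^ (-(1 / 2) : ℝ) ≤ -(15 / 8) * (x + 3) ^ (-(7 / 2) : ℝ) := by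
  have hder : ∀ (p a y : ℝ), 0 < y + a →
      HasDerivAt (fun y : ℝ => (y + a) ^ p) (p * (y + a) ^ (p - 1)) y := by
    intro p a y hy
    simpa using ((hasDerivAt_id y).add_const a).rpow_const (p := p) (Or.inl hy.ne')
  have h2 : ∀ y ∈ Set.Icc x (x + 2),
      3 / 4 * (y + 1) ^ (-(5 / 2) : ℝ) - 3 / 4 * y ^ (-(5 / 2) : ℝ)
        ≤ -(15 / 8) * (x + 3) ^ (-(7 / 2) : ℝ) := by
    intro y hy
    refine sub_le_of_hasDerivAt_le (f := fun y => 3 / 4 * y ^ (-(5 / 2) : ℝ))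
      (f' := fun y => -(15 / 8) * y ^ (-(7 / 2) : ℝ)) (fun z hz => ?_) fun z hz => ?_
    · have hz0 : 0 < z := by linarith [hy.1, hz.1]
      have := (hder (-(5 / 2)) 0 z (by simpa using hz0)).const_mul (3 / 4)
      simp only [add_zero] at this
      refine this.congr_deriv ?_
      norm_num
      ring
    · have hz0 : 0 < z := by linarith [hy.1, hz.1]
      have : (x + 3) ^ (-(7 / 2) : ℝ) ≤ z ^ (-(7 / 2) : ℝ) :=
        Real.rpow_le_rpow_of_nonpos hz0 (by linarith [hy.2, hz.2]) (by norm_num)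
      linarith
  have h1 : ∀ y ∈ Set.Icc x (x + 1),
      (-(1 / 2) * (y + 1 + 1) ^ (-(3 / 2) : ℝ) - -(1 / 2) * (y + 1) ^ (-(3 / 2) : ℝ)) -
        (-(1 / 2) * (y + 1) ^ (-(3 / 2) : ℝ) - -(1 / 2) * y ^ (-(3 / 2) : ℝ))
        ≤ -(15 / 8) * (x + 3) ^ (-(7 / 2) : ℝ) := by
    intro y hy
    refine sub_le_of_hasDerivAt_le
      (f := fun y => -(1 / 2) * (y + 1) ^ (-(3 / 2) : ℝ) - -(1 / 2) * y ^ (-(3 / 2) : ℝ))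
      (f' := fun y => 3 / 4 * (y + 1) ^ (-(5 / 2) : ℝ) - 3 / 4 * y ^ (-(5 / 2) : ℝ))
      (fun z hz => ?_) fun z hz => h2 z ⟨by linarith [hy.1, hz.1], by linarith [hy.2, hz.2]⟩
    have hz0 : 0 < z := by linarith [hy.1, hz.1]
    have e1 := (hder (-(3 / 2)) 1 z (by linarith)).const_mul (-(1 / 2))
    have e2 := (hder (-(3 / 2)) 0 z (by linarith)).const_mul (-(1 / 2))
    simp only [add_zero] at e2
    refine (e1.fun_sub e2).congr_deriv ?_
    norm_num
    ring
  have h0 := sub_le_of_hasDerivAt_le (x := x) (C := -(15 / 8) * (x + 3) ^ (-(7 / 2) : ℝ))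
    (f := fun y => ((y + 2) ^ (-(1 / 2) : ℝ) - (y + 1) ^ (-(1 / 2) : ℝ)) -
      ((y + 1) ^ (-(1 / 2) : ℝ) - y ^ (-(1 / 2) : ℝ)))
    (f' := fun y => (-(1 / 2) * (y + 1 + 1) ^ (-(3 / 2) : ℝ)
      - -(1 / 2) * (y + 1) ^ (-(3 / 2) : ℝ)) -
        (-(1 / 2) * (y + 1) ^ (-(3 / 2) : ℝ) - -(1 / 2) * y ^ (-(3 / 2) : ℝ)))
    (fun y hy => ?_) h1
  · have a1 : x + 1 + 2 = x + 3 := by ring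
    have a2 : x + 1 + 1 = x + 2 := by ring
    simp only [a1, a2] at h0
    linarith
  · have hy0 : 0 < y := by linarith [hy.1]
    have e2 := hder (-(1 / 2)) 2 y (by linarith)
    have e1 := hder (-(1 / 2)) 1 y (by linarith)
    have e0 := hder (-(1 / 2)) 0 y (by linarith)
    simp only [add_zero] at e0
    refine ((e2.fun_sub e1).fun_sub (e1.fun_sub e0)).congr_deriv ?_
    norm_num [add_assoc]

theorem discr_neg_of_differences {C c t a₀ d₁ d₂ d₃ : ℝ} (hC : 1 ≤ C) (hc : 0 < c) (ht : 0 < t)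
    (ht1 : t ≤ 1) (htc : C ^ 2 * t ^ 2 ≤ c / 4) (htc' : 24 * C ^ 4 * t ^ 2 < c ^ 2 / 16)
    (ha : 1 / 2 ≤ a₀) (ha' : a₀ ≤ 2) (h1 : |d₁| ≤ C * t ^ 6) (h2 : |d₂| ≤ C * t ^ 10)
    (h3 : |d₃| ≤ C * t ^ 14) (h3' : c * t ^ 14 ≤ |d₃|) :
    4 * (d₁ ^ 2 - a₀ * d₂) * (d₂ ^ 2 - d₁ * d₃) < (d₁ * d₂ - a₀ * d₃) ^ 2 := by
  have hR : c / 4 * t ^ 14 ≤ |d₁ * d₂ - a₀ * d₃| := by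
    have e1 : |a₀ * d₃| - |d₁ * d₂| ≤ |d₁ * d₂ - a₀ * d₃| := by
      rw [abs_sub_comm (d₁ * d₂)]; exact abs_sub_abs_le_abs_sub _ _
    have e2 : |d₁ * d₂| ≤ c / 4 * t ^ 14 := by
      calc |d₁ * d₂| = |d₁| * |d₂| := abs_mul _ _
        _ ≤ (C * t ^ 6) * (C * t ^ 10) := by gcongr
        _ = (C ^ 2 * t ^ 2) * t ^ 14 := by ring
        _ ≤ _ := by gcongr
    have e3 : c / 2 * t ^ 14 ≤ |a₀ * d₃| := by
      rw [abs_mul, abs_of_pos (by linarith : (0 : ℝ) < a₀)]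
      calc c / 2 * t ^ 14 = 1 / 2 * (c * t ^ 14) := by ring
        _ ≤ a₀ * |d₃| := by gcongr
    linarith
  have hR2 : (c / 4 * t ^ 14) ^ 2 ≤ (d₁ * d₂ - a₀ * d₃) ^ 2 := by
    rw [← sq_abs (d₁ * d₂ - a₀ * d₃)]; gcongr
  have hL1 : |d₁ ^ 2 - a₀ * d₂| ≤ 3 * C ^ 2 * t ^ 10 := by
    calc |d₁ ^ 2 - a₀ * d₂| ≤ |d₁ ^ 2| + |a₀ * d₂| := abs_sub _ _
      _ = |d₁| ^ 2 + a₀ * |d₂| := by rw [abs_mul, abs_pow, abs_of_pos (by linarith : (0 : ℝ) < a₀)]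
      _ ≤ (C * t ^ 6) ^ 2 + 2 * (C * t ^ 10) := by gcongr
      _ = C ^ 2 * t ^ 2 * t ^ 10 + 2 * C * t ^ 10 := by ring
      _ ≤ C ^ 2 * 1 * t ^ 10 + 2 * C ^ 2 * t ^ 10 := by
        gcongr
        · exact pow_le_one₀ ht.le ht1
        · nlinarith
      _ = _ := by ring
  have hL2 : |d₂ ^ 2 - d₁ * d₃| ≤ 2 * C ^ 2 * t ^ 20 := by
    calc |d₂ ^ 2 - d₁ * d₃| ≤ |d₂ ^ 2| + |d₁ * d₃| := abs_sub _ _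
      _ = |d₂| ^ 2 + |d₁| * |d₃| := by rw [abs_mul, abs_pow]
      _ ≤ (C * t ^ 10) ^ 2 + (C * t ^ 6) * (C * t ^ 14) := by gcongr
      _ = _ := by ring
  have ht28 : 0 < t ^ 28 := by positivity
  calc 4 * (d₁ ^ 2 - a₀ * d₂) * (d₂ ^ 2 - d₁ * d₃)
      ≤ |4 * (d₁ ^ 2 - a₀ * d₂) * (d₂ ^ 2 - d₁ * d₃)| := le_abs_self _
    _ = 4 * |d₁ ^ 2 - a₀ * d₂| * |d₂ ^ 2 - d₁ * d₃| := by rw [abs_mul, abs_mul]; norm_num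
    _ ≤ 4 * (3 * C ^ 2 * t ^ 10) * (2 * C ^ 2 * t ^ 20) := by gcongr
    _ = (24 * C ^ 4 * t ^ 2) * t ^ 28 := by ring
    _ < c ^ 2 / 16 * t ^ 28 := by gcongr
    _ = (c / 4 * t ^ 14) ^ 2 := by ring
    _ ≤ _ := hR2
/-- The exponent in the saddle point integral. -/
noncomputable def saddlePhase (u : ℝ) : ℂ := (u : ℂ) ^ 2 / (1 + u * Complex.I)

/-- The amplitude in the saddle point integral. -/
noncomputable def saddleAmp (u : ℝ) : ℂ := (1 + u * Complex.I) ^ (1 / 2 : ℂ)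

/-- The saddle point integral. -/
noncomputable def saddleInt (t : ℂ) : ℂ :=
  ∫ u in (-1 : ℝ)..1, saddleAmp u * Complex.exp (-t * saddlePhase u)

theorem one_add_mul_I_mem_slitPlane (u : ℝ) : (1 + u * Complex.I : ℂ) ∈ Complex.slitPlane := by
  left; simp

theorem one_add_mul_I_ne_zero (u : ℝ) : (1 + u * Complex.I : ℂ) ≠ 0 :=
  Complex.slitPlane_ne_zero (one_add_mul_I_mem_slitPlane u)

theorem continuous_saddlePhase : Continuous saddlePhase := by
  unfold saddlePhase
  exact Continuous.div (by fun_prop) (by fun_prop) one_add_mul_I_ne_zero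

theorem continuous_saddleAmp : Continuous saddleAmp := by
  unfold saddleAmp
  exact Continuous.cpow (by fun_prop) continuous_const one_add_mul_I_mem_slitPlane

theorem norm_saddleAmp_le {u : ℝ} (hu : |u| ≤ 1) : ‖saddleAmp u‖ ≤ 2 := by
  have h2 : ‖(1 + u * Complex.I : ℂ)‖ ≤ 2 := by
    refine (norm_add_le _ _).trans ?_
    simp
    linarith
  have : ‖saddleAmp u‖ = ‖(1 + u * Complex.I : ℂ)‖ ^ (1 / 2 : ℝ) := by
    unfold saddleAmp
    rw [← Complex.norm_cpow_real]
    norm_num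
  rw [this]
  calc ‖(1 + u * Complex.I : ℂ)‖ ^ (1 / 2 : ℝ) ≤ 2 ^ (1 / 2 : ℝ) := by gcongr
    _ ≤ 2 ^ (1 : ℝ) := by gcongr <;> norm_num
    _ = 2 := by norm_num

theorem saddleAmp_zero : saddleAmp 0 = 1 := by simp [saddleAmp]

theorem norm_saddlePhase_le (u : ℝ) : ‖saddlePhase u‖ ≤ u ^ 2 := by
  unfold saddlePhase
  rw [norm_div, norm_pow, Complex.norm_real, Real.norm_eq_abs, sq_abs]
  refine div_le_self (sq_nonneg u) ?_
  have := Complex.abs_re_le_norm (1 + u * Complex.I)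
  simpa using this

theorem re_mul_saddlePhase_ge {t : ℂ} {u : ℝ} (hu : |u| ≤ 1) (ht : |t.im| ≤ t.re) :
    u ^ 2 / 2 * (t.re - |t.im|) ≤ (t * saddlePhase u).re := by
  have hu2 : u ^ 2 ≤ 1 := by rw [← sq_abs]; exact pow_le_one₀ (abs_nonneg u) hu
  have e : (t * saddlePhase u).re = u ^ 2 / (1 + u ^ 2) * (t.re + u * t.im) := by
    have : saddlePhase u = ((u ^ 2 / (1 + u ^ 2) : ℝ) : ℂ) * (1 - u * Complex.I) := by
      unfold saddlePhase
      have h1 : (1 + (u : ℂ) ^ 2) = (1 + u * Complex.I) * (1 - u * Complex.I) := by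
        ring_nf; simp
      have h0 : (1 + (u : ℂ) ^ 2) ≠ 0 := by
        have : (1 + u ^ 2 : ℝ) ≠ 0 := by positivity
        exact_mod_cast this
      have := one_add_mul_I_ne_zero u
      push_cast
      rw [div_mul_eq_mul_div, div_eq_div_iff this h0, h1]
      ring
    rw [this, mul_left_comm, Complex.re_ofReal_mul]
    congr 1
    simp
    ring
  rw [e]
  have h1 : -|t.im| ≤ u * t.im := by
    have : |u * t.im| ≤ |t.im| := by
      rw [abs_mul]; exact mul_le_of_le_one_left (abs_nonneg _) hu
    exact (abs_le.1 this).1.trans' (by linarith)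
  have h2 : u ^ 2 / 2 ≤ u ^ 2 / (1 + u ^ 2) := by
    gcongr; linarith
  have h3 : 0 ≤ t.re - |t.im| := by linarith
  calc u ^ 2 / 2 * (t.re - |t.im|) ≤ u ^ 2 / (1 + u ^ 2) * (t.re - |t.im|) := by gcongr
    _ ≤ _ := by gcongr; linarith

theorem differentiable_saddleInt : Differentiable ℂ saddleInt := by
  intro t₀
  have hc : ∀ t : ℂ, Continuous fun u => saddleAmp u * Complex.exp (-t * saddlePhase u) := by
    intro t
    have := continuous_saddlePhase
    have := continuous_saddleAmp
    fun_prop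
  have hc' : ∀ t : ℂ, Continuous fun u =>
      saddleAmp u * (Complex.exp (-t * saddlePhase u) * (-saddlePhase u)) := by
    intro t
    have := continuous_saddlePhase
    have := continuous_saddleAmp
    fun_prop
  have := intervalIntegral.hasDerivAt_integral_of_dominated_loc_of_deriv_le
    (μ := MeasureTheory.volume) (a := -1) (b := 1)
    (F := fun t u => saddleAmp u * Complex.exp (-t * saddlePhase u))
    (F' := fun t u => saddleAmp u * (Complex.exp (-t * saddlePhase u) * (-saddlePhase u)))
    (x₀ := t₀) (bound := fun _ => 2 * (Real.exp (‖t₀‖ + 1) * 1)) (Metric.ball_mem_nhds t₀ one_pos)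
    (.of_forall fun t => (hc t).aestronglyMeasurable) ((hc t₀).intervalIntegrable _ _)
    (hc' t₀).aestronglyMeasurable (.of_forall fun u hu t ht => ?_) (by simp)
    (.of_forall fun u hu t ht => ?_)
  · exact this.2.differentiableAt
  · have hu1 : |u| ≤ 1 := by
      rw [Set.uIoc_of_le (by norm_num)] at hu
      exact abs_le.2 ⟨hu.1.le, hu.2⟩
    have hu2 : ‖saddlePhase u‖ ≤ 1 := (norm_saddlePhase_le u).trans (by
      rw [← sq_abs]; exact pow_le_one₀ (abs_nonneg u) hu1)
    have ht' : ‖t‖ ≤ ‖t₀‖ + 1 := by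
      have h1 := norm_sub_norm_le t t₀
      rw [mem_ball_iff_norm] at ht
      linarith
    rw [norm_mul, norm_mul, norm_neg]
    gcongr
    · exact norm_saddleAmp_le hu1
    · refine (Complex.norm_exp_le_exp_norm _).trans (Real.exp_le_exp.2 ?_)
      rw [norm_mul, norm_neg]
      calc ‖t‖ * ‖saddlePhase u‖ ≤ (‖t₀‖ + 1) * 1 := by gcongr
        _ = _ := by ring
  · refine HasDerivAt.const_mul _ (HasDerivAt.cexp ?_)
    simpa using ((hasDerivAt_id t).neg.mul_const (saddlePhase u))

theorem norm_saddleInt_sub_le {t : ℂ} {T : ℝ} (hT : 0 < T) (ht : ‖t - T‖ ≤ T / 200) :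
    ‖saddleInt t - saddleInt T‖ ≤ 1 / 2 * T ^ (-(1 / 2) : ℝ) := by
  have hball : ∀ z ∈ Metric.closedBall (T : ℂ) (T / 200), ∀ u : ℝ, |u| ≤ 1 →
      u ^ 2 * T / 4 ≤ (z * saddlePhase u).re := by
    intro z hz u hu
    rw [mem_closedBall_iff_norm] at hz
    have h1 := (Complex.abs_re_le_norm (z - T)).trans hz
    have h2 := (Complex.abs_im_le_norm (z - T)).trans hz
    simp only [Complex.sub_re, Complex.ofReal_re, Complex.sub_im, Complex.ofReal_im,
      sub_zero] at h1 h2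
    have h3 := (abs_le.1 h1).1
    refine le_trans ?_ (re_mul_saddlePhase_ge hu (by linarith))
    have : T / 2 ≤ z.re - |z.im| := by linarith
    calc u ^ 2 * T / 4 = u ^ 2 / 2 * (T / 2) := by ring
      _ ≤ _ := by gcongr
  have hexp : ∀ u : ℝ, |u| ≤ 1 →
      ‖Complex.exp (-t * saddlePhase u) - Complex.exp (-T * saddlePhase u)‖
        ≤ u ^ 2 * Real.exp (-(u ^ 2 * T / 4)) * ‖t - T‖ := by
    intro u hu
    refine (convex_closedBall (T : ℂ) (T / 200)).norm_image_sub_le_of_norm_hasDerivWithin_le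
      (f := fun z => Complex.exp (-z * saddlePhase u))
      (f' := fun z => Complex.exp (-z * saddlePhase u) * (-saddlePhase u)) (fun z hz => ?_)
      (fun z hz => ?_) (Metric.mem_closedBall_self (by positivity))
      (by simpa [dist_eq_norm] using ht)
    · refine (HasDerivAt.cexp ?_).hasDerivWithinAt
      simpa using ((hasDerivAt_id z).neg.mul_const (saddlePhase u))
    · rw [norm_mul, norm_neg, Complex.norm_exp, mul_comm]
      have := hball z hz u hu
      gcongr
      · exact norm_saddlePhase_le u
      · rw [neg_mul, Complex.neg_re]; linarith
  have hc : ∀ t : ℂ, Continuous fun u => saddleAmp u * Complex.exp (-t * saddlePhase u) := by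
    intro t
    have := continuous_saddlePhase
    have := continuous_saddleAmp
    fun_prop
  have h_int : MeasureTheory.Integrable fun u : ℝ => 2 / 25 * Real.exp (-(T / 8) * u ^ 2) :=
    (integrable_exp_neg_mul_sq (by positivity)).const_mul _
  have hpt : ∀ u ∈ Set.Ioc (-1 : ℝ) 1, ‖saddleAmp u * Complex.exp (-t * saddlePhase u) -
      saddleAmp u * Complex.exp (-T * saddlePhase u)‖ ≤ 2 / 25 * Real.exp (-(T / 8) * u ^ 2) := by
    intro u hu
    have hu1 : |u| ≤ 1 := abs_le.2 ⟨hu.1.le, hu.2⟩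
    rw [← mul_sub, norm_mul]
    have h1 : T * u ^ 2 / 8 ≤ Real.exp (T * u ^ 2 / 8) := by
      linarith [Real.add_one_le_exp (T * u ^ 2 / 8)]
    calc _ ≤ 2 * (u ^ 2 * Real.exp (-(u ^ 2 * T / 4)) * (T / 200)) := by
          gcongr
          · exact norm_saddleAmp_le hu1
          · exact (hexp u hu1).trans (by gcongr)
      _ = 2 / 25 * ((T * u ^ 2 / 8) * Real.exp (-(u ^ 2 * T / 4))) := by ring
      _ ≤ 2 / 25 * (Real.exp (T * u ^ 2 / 8) * Real.exp (-(u ^ 2 * T / 4))) := by gcongr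
      _ = _ := by rw [← Real.exp_add]; ring_nf
  calc ‖saddleInt t - saddleInt T‖
      = ‖∫ u in (-1 : ℝ)..1, (saddleAmp u * Complex.exp (-t * saddlePhase u)
        - saddleAmp u * Complex.exp (-T * saddlePhase u))‖ := by
        rw [intervalIntegral.integral_sub ((hc _).intervalIntegrable _ _)
          ((hc _).intervalIntegrable _ _)]
        rfl
    _ ≤ ∫ u in (-1 : ℝ)..1, 2 / 25 * Real.exp (-(T / 8) * u ^ 2) :=
        intervalIntegral.norm_integral_le_of_norm_le (by norm_num) (.of_forall hpt)
          h_int.intervalIntegrable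
    _ ≤ ∫ u : ℝ, 2 / 25 * Real.exp (-(T / 8) * u ^ 2) := by
        rw [intervalIntegral.integral_of_le (by norm_num)]
        exact MeasureTheory.setIntegral_le_integral h_int (.of_forall fun u => by positivity)
    _ = 2 / 25 * (√(8 * π) * T ^ (-(1 / 2) : ℝ)) := by
        rw [MeasureTheory.integral_const_mul, integral_gaussian, Real.rpow_neg hT.le,
          ← Real.sqrt_eq_rpow, ← div_eq_mul_inv, ← Real.sqrt_div (by positivity)]
        congr 2
        field_simp
    _ ≤ _ := by
        have : √(8 * π) ≤ 6 := by
          rw [Real.sqrt_le_left (by norm_num)]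
          linarith [Real.pi_lt_d2]
        have h0 : 0 ≤ T ^ (-(1 / 2) : ℝ) := by positivity
        nlinarith

theorem norm_saddleInt_le (T : ℝ) (hT : 0 ≤ T) : ‖saddleInt T‖ ≤ 4 := by
  have := intervalIntegral.norm_integral_le_of_norm_le_const (a := -1) (b := 1) (C := 2)
    (f := fun u => saddleAmp u * Complex.exp (-T * saddlePhase u)) fun u hu => ?_
  · refine this.trans (by norm_num)
  · rw [Set.uIoc_of_le (by norm_num)] at hu
    have hu1 : |u| ≤ 1 := abs_le.2 ⟨hu.1.le, hu.2⟩
    have h1 := re_mul_saddlePhase_ge (t := T) hu1 (by simpa)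
    rw [norm_mul, Complex.norm_exp]
    have : Real.exp (-T * saddlePhase u).re ≤ 1 := by
      rw [Real.exp_le_one_iff, neg_mul, Complex.neg_re]
      simp only [Complex.ofReal_re, Complex.ofReal_im, abs_zero, sub_zero] at h1
      have : 0 ≤ u ^ 2 / 2 * T := by positivity
      linarith
    calc _ ≤ 2 * (1 : ℝ) := by gcongr; exact norm_saddleAmp_le hu1
      _ = 2 := by norm_num

open Filter Topology in
theorem tendsto_mul_saddleInt_sq :
    Tendsto (fun M : ℝ => (M : ℂ) * saddleInt ((M : ℂ) ^ 2)) atTop (𝓝 ((√π : ℝ) : ℂ)) := by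
  have key : Tendsto (fun M : ℝ => ∫ v : ℝ, (Set.Ioc (-M) M).indicator
      (fun v => saddleAmp (v / M) * Complex.exp (-(M : ℂ) ^ 2 * saddlePhase (v / M))) v) atTop
      (𝓝 (∫ v : ℝ, ((Real.exp (-1 * v ^ 2) : ℝ) : ℂ))) := by
    refine MeasureTheory.tendsto_integral_filter_of_dominated_convergence
      (fun v => 2 * Real.exp (-(1 / 2) * v ^ 2)) ?_ ?_ ?_ ?_
    · refine .of_forall fun M => ?_
      have h1 := continuous_saddlePhase
      have h2 := continuous_saddleAmp
      have : Continuous fun v : ℝ =>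
          saddleAmp (v / M) * Complex.exp (-(M : ℂ) ^ 2 * saddlePhase (v / M)) := by fun_prop
      exact this.aestronglyMeasurable.indicator measurableSet_Ioc
    · filter_upwards [eventually_gt_atTop 0] with M hM
      refine .of_forall fun v => ?_
      by_cases hv : v ∈ Set.Ioc (-M) M
      · rw [Set.indicator_of_mem hv, norm_mul, Complex.norm_exp]
        have hu : |v / M| ≤ 1 := by
          rw [abs_div, abs_of_pos hM, div_le_one hM]
          exact abs_le.2 ⟨hv.1.le, hv.2⟩
        have h1 := re_mul_saddlePhase_ge (t := (M : ℂ) ^ 2) hu (by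
          rw [← Complex.ofReal_pow, Complex.ofReal_re, Complex.ofReal_im]; simpa using sq_nonneg M)
        gcongr
        · exact norm_saddleAmp_le hu
        · rw [neg_mul, Complex.neg_re]
          rw [← Complex.ofReal_pow] at h1 ⊢
          simp only [Complex.ofReal_re, Complex.ofReal_im, abs_zero, sub_zero] at h1
          have : (v / M) ^ 2 / 2 * M ^ 2 = 1 / 2 * v ^ 2 := by field_simp
          linarith
      · rw [Set.indicator_of_notMem hv, norm_zero]
        positivity
    · exact (integrable_exp_neg_mul_sq (by norm_num)).const_mul _
    · refine .of_forall fun v => ?_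
      have hlim : Tendsto (fun M : ℝ => v / M) atTop (𝓝 0) :=
        tendsto_const_nhds.div_atTop tendsto_id
      have h1 : Tendsto (fun M : ℝ => saddleAmp (v / M)) atTop (𝓝 1) := by
        rw [← saddleAmp_zero]
        exact (continuous_saddleAmp.tendsto 0).comp hlim
      have h2 : Tendsto (fun M : ℝ => -((v : ℂ) ^ 2 / (1 + ((v / M : ℝ) : ℂ) * Complex.I))) atTop
          (𝓝 (-((v : ℂ) ^ 2 / (1 + ((0 : ℝ) : ℂ) * Complex.I)))) := by
        have : Continuous fun u : ℝ => -((v : ℂ) ^ 2 / (1 + u * Complex.I)) :=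
          (Continuous.div (by fun_prop) (by fun_prop) one_add_mul_I_ne_zero).neg
        exact (this.tendsto 0).comp hlim
      have h3 := h1.mul h2.cexp
      have e : (1 : ℂ) * Complex.exp (-((v : ℂ) ^ 2 / (1 + ((0 : ℝ) : ℂ) * Complex.I)))
          = ((Real.exp (-1 * v ^ 2) : ℝ) : ℂ) := by
        push_cast
        simp
      rw [e] at h3
      refine h3.congr' ?_
      filter_upwards [eventually_gt_atTop |v|] with M hM
      have hM0 : 0 < M := (abs_nonneg v).trans_lt hM
      have hM' : (M : ℂ) ≠ 0 := by exact_mod_cast hM0.ne'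
      have hv : v ∈ Set.Ioc (-M) M := ⟨(abs_lt.1 hM).1, (abs_lt.1 hM).2.le⟩
      rw [Set.indicator_of_mem hv]
      congr 2
      unfold saddlePhase
      push_cast
      field_simp
  have hval : (∫ v : ℝ, ((Real.exp (-1 * v ^ 2) : ℝ) : ℂ)) = ((√π : ℝ) : ℂ) := by
    rw [integral_complex_ofReal, integral_gaussian, div_one]
  rw [hval] at key
  refine key.congr' ?_
  filter_upwards [eventually_gt_atTop 0] with M hM
  rw [MeasureTheory.integral_indicator measurableSet_Ioc,
    ← intervalIntegral.integral_of_le (by linarith)]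
  have := intervalIntegral.integral_comp_div (a := -M) (b := M) (c := M)
    (fun u => saddleAmp u * Complex.exp (-(M : ℂ) ^ 2 * saddlePhase u)) hM.ne'
  rw [this, neg_div, div_self hM.ne', Complex.real_smul]
  rfl

open Filter Topology in
theorem eventually_le_re_saddleInt :
    ∀ᶠ T : ℝ in atTop, ∀ t : ℂ, ‖t - T‖ ≤ T / 200 →
      1 / 2 * T ^ (-(1 / 2) : ℝ) ≤ (saddleInt t).re ∧ ‖saddleInt t‖ ≤ 5 := by
  have h1 : Tendsto (fun T : ℝ => √T) atTop atTop := Real.tendsto_sqrt_atTop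
  have h2 := ((Complex.continuous_re.tendsto _).comp tendsto_mul_saddleInt_sq).comp h1
  have hpi : (1 : ℝ) < √π := by
    rw [Real.lt_sqrt (by norm_num)]; linarith [Real.pi_gt_three]
  have h3 := h2.eventually (lt_mem_nhds (by simpa using hpi))
  filter_upwards [h3, eventually_ge_atTop 1] with T hT hT1 t ht
  have hT0 : 0 < T := by linarith
  simp only [Function.comp_apply, Complex.re_ofReal_mul] at hT
  rw [← Complex.ofReal_pow, Real.sq_sqrt hT0.le] at hT
  have hs := norm_saddleInt_sub_le hT0 ht
  have hr : T ^ (-(1 / 2) : ℝ) = (√T)⁻¹ := by rw [Real.rpow_neg hT0.le, Real.sqrt_eq_rpow]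
  have hsq : 0 < √T := Real.sqrt_pos.2 hT0
  have hre : T ^ (-(1 / 2) : ℝ) ≤ (saddleInt T).re := by
    rw [hr, inv_le_iff_one_le_mul₀' hsq]; exact hT.le
  have h4 := (Complex.abs_re_le_norm _).trans hs
  rw [Complex.sub_re] at h4
  refine ⟨by linarith [(abs_le.1 h4).1], ?_⟩
  have h5 : T ^ (-(1 / 2) : ℝ) ≤ 1 := Real.rpow_le_one_of_one_le_of_nonpos hT1 (by norm_num)
  have h6 := norm_sub_norm_le (saddleInt t) (saddleInt T)
  linarith [norm_saddleInt_le T hT0.le]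
theorem eulerPhi_zero : eulerPhi 0 = 1 := by simp [eulerPhi]

theorem eta_I_mul_div (s : ℂ) : ModularForm.eta (Complex.I * s / (2 * π)) =
    Complex.exp (-s / 24) * eulerPhi (Complex.exp (-s)) := by
  have hpi : (π : ℂ) ≠ 0 := by exact_mod_cast Real.pi_ne_zero
  have e : 2 * (π : ℂ) * Complex.I * (Complex.I * s / (2 * π)) = -s := by
    field_simp
    rw [Complex.I_sq]
    ring
  unfold ModularForm.eta eulerPhi
  congr 1
  · rw [Function.Periodic.qParam, e]; simp
  · refine tprod_congr fun n => ?_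
    rw [ModularForm.eta_q_eq_pow, e]

theorem arg_abs_lt_of_re_pos {s : ℂ} (hs : 0 < s.re) : |s.arg| < π / 2 :=
  Complex.abs_arg_lt_pi_div_two_iff.2 (Or.inl hs)

theorem eta_inversion {s : ℂ} (hs : 0 < s.re) :
    Complex.exp (-(4 * π ^ 2 / s) / 24) * eulerPhi (Complex.exp (-(4 * π ^ 2 / s))) =
      (s / (2 * π)) ^ (1 / 2 : ℂ) * (Complex.exp (-s / 24) * eulerPhi (Complex.exp (-s))) := by
  have hpi : (π : ℂ) ≠ 0 := by exact_mod_cast Real.pi_ne_zero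
  have hs0 : s ≠ 0 := by rintro rfl; simp at hs
  set r := s / (2 * π) with hr
  have hr0 : r ≠ 0 := by rw [hr]; exact div_ne_zero hs0 (mul_ne_zero two_ne_zero hpi)
  have hrre : 0 < r.re := by
    have : r = ((1 / (2 * π) : ℝ) : ℂ) * s := by rw [hr]; push_cast; field_simp
    rw [this, Complex.re_ofReal_mul]
    positivity
  have hmem : Complex.I * r ∈ UpperHalfPlane.upperHalfPlaneSet := by
    simpa using hrre
  have h := ModularForm.eta_comp_eq_csqrt_I_inv hmem
  have e1 : -1 / (Complex.I * r) = Complex.I * (4 * π ^ 2 / s) / (2 * π) := by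
    rw [hr]
    field_simp
    rw [Complex.I_sq]
    ring
  have e2 : Complex.I * r = Complex.I * s / (2 * π) := by rw [hr]; ring
  have e3 : Complex.sqrt (Complex.I * r) = Complex.sqrt Complex.I * r ^ (1 / 2 : ℂ) := by
    unfold Complex.sqrt
    have harg := abs_lt.1 (arg_abs_lt_of_re_pos hrre)
    have hmem' : Complex.arg Complex.I + r.arg ∈ Set.Ioc (-π) π := by
      rw [Complex.arg_I]
      constructor <;> linarith [Real.pi_pos]
    rw [Complex.cpow_def_of_ne_zero (mul_ne_zero Complex.I_ne_zero hr0),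
      Complex.cpow_def_of_ne_zero Complex.I_ne_zero, Complex.cpow_def_of_ne_zero hr0,
      (Complex.log_mul_eq_add_log_iff Complex.I_ne_zero hr0).2 hmem', ← Complex.exp_add]
    ring_nf
  have hI : Complex.sqrt Complex.I ≠ 0 := by
    simp [Complex.sqrt]
  simp only [Function.comp_apply, Pi.smul_apply, Pi.mul_apply, smul_eq_mul] at h
  rw [e1, eta_I_mul_div, e3, e2, eta_I_mul_div] at h
  rw [h]
  field_simp

theorem overGen_exp_neg {s : ℂ} (hs : 0 < s.re) : overGen (Complex.exp (-s)) =
    1 / 2 * (s / π) ^ (1 / 2 : ℂ) * Complex.exp (π ^ 2 / (4 * s)) *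
      (eulerPhi (Complex.exp (-(2 * π ^ 2 / s))) /
        eulerPhi (Complex.exp (-(2 * π ^ 2 / s)) ^ 2) ^ 2) := by
  have hpi : (π : ℂ) ≠ 0 := by exact_mod_cast Real.pi_ne_zero
  have hs0 : s ≠ 0 := by rintro rfl; simp at hs
  have hcpow : ∀ z : ℂ, (z ^ (1 / 2 : ℂ)) ^ 2 = z := by
    intro z
    rw [← Complex.cpow_nat_mul]
    norm_num
  have hn : ∀ z : ℂ, 0 < z.re → eulerPhi (Complex.exp (-z)) ≠ 0 := by
    intro z hz
    refine eulerPhi_ne_zero ?_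
    rw [Complex.norm_exp, Real.exp_lt_one_iff]
    simpa using hz
  have h1 := eta_inversion hs
  have h2 := eta_inversion (s := 2 * s) (by simpa using hs)
  have e1 : 4 * (π : ℂ) ^ 2 / (2 * s) = 2 * π ^ 2 / s := by field_simp; ring
  have e2 : 2 * s / (2 * (π : ℂ)) = s / π := by field_simp
  rw [e1, e2] at h2
  have g1 : Complex.exp (-s) ^ 2 = Complex.exp (-(2 * s)) := by
    rw [← Complex.exp_nat_mul]; push_cast; ring_nf
  have g2 : Complex.exp (-(2 * π ^ 2 / s)) ^ 2 = Complex.exp (-(4 * π ^ 2 / s)) := by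
    rw [← Complex.exp_nat_mul]; push_cast; ring_nf
  have hA := hn s hs
  have hB := hn (4 * π ^ 2 / s) (by
    have : 4 * (π : ℂ) ^ 2 / s = ((4 * π ^ 2 : ℝ) : ℂ) * s⁻¹ := by push_cast; ring
    rw [this, Complex.re_ofReal_mul, Complex.inv_re]
    have := Complex.normSq_pos.2 hs0
    positivity)
  unfold overGen
  rw [g1, g2]
  set P1 := eulerPhi (Complex.exp (-s))
  set P2 := eulerPhi (Complex.exp (-(2 * s)))
  set Q1 := eulerPhi (Complex.exp (-(4 * π ^ 2 / s)))
  set Q2 := eulerPhi (Complex.exp (-(2 * π ^ 2 / s)))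
  have hr : (s / π) ^ (1 / 2 : ℂ) ≠ 0 := by
    intro h
    have := hcpow (s / π)
    rw [h] at this
    have h3 : s / (π : ℂ) ≠ 0 := div_ne_zero hs0 hpi
    exact h3 (by rw [← this]; simp)
  have h1' : Q1 ^ 2 = s / (2 * π) * P1 ^ 2 *
      (Complex.exp (-s / 24) ^ 2 / Complex.exp (-(4 * π ^ 2 / s) / 24) ^ 2) := by
    have := Complex.exp_ne_zero (-(4 * π ^ 2 / s) / 24)
    rw [mul_div_assoc', eq_div_iff (pow_ne_zero 2 this)]
    have h3 := congrArg (· ^ 2) h1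
    simp only [mul_pow, hcpow] at h3
    linear_combination h3
  have h2' : Q2 = (s / π) ^ (1 / 2 : ℂ) * P2 *
      (Complex.exp (-(2 * s) / 24) / Complex.exp (-(2 * π ^ 2 / s) / 24)) := by
    have := Complex.exp_ne_zero (-(2 * π ^ 2 / s) / 24)
    rw [mul_div_assoc', eq_div_iff this]
    linear_combination h2
  rw [h1', h2', ← Complex.exp_sub, ← Complex.exp_nat_mul, ← Complex.exp_nat_mul, ← Complex.exp_sub]
  have e3 : Complex.exp (π ^ 2 / (4 * s)) = Complex.exp (((2 : ℕ) : ℂ) * (-s / 24) -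
      ((2 : ℕ) : ℂ) * (-(4 * π ^ 2 / s) / 24)) /
        Complex.exp (-(2 * s) / 24 - -(2 * π ^ 2 / s) / 24) := by
    rw [← Complex.exp_sub]
    congr 1
    push_cast
    field_simp
    ring
  rw [e3]
  have k1 := Complex.exp_ne_zero
    (((2 : ℕ) : ℂ) * (-s / 24) - ((2 : ℕ) : ℂ) * (-(4 * π ^ 2 / s) / 24))
  have k2 := Complex.exp_ne_zero (-(2 * s) / 24 - -(2 * π ^ 2 / s) / 24)
  have h4 := hcpow (s / π)
  generalize Complex.exp
    (((2 : ℕ) : ℂ) * (-s / 24) - ((2 : ℕ) : ℂ) * (-(4 * π ^ 2 / s) / 24)) = X at *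
  generalize Complex.exp (-(2 * s) / 24 - -(2 * π ^ 2 / s) / 24) = Y at *
  generalize (s / π) ^ (1 / 2 : ℂ) = r at *
  have hs' : s = r ^ 2 * π := by rw [h4]; field_simp
  rw [hs']
  field_simp

theorem exists_norm_eulerPhi_ratio_sub_one_le : ∃ C ρ : ℝ, 0 < C ∧ 0 < ρ ∧ ∀ w : ℂ, ‖w‖ ≤ ρ →
    ‖eulerPhi w / eulerPhi (w ^ 2) ^ 2 - 1‖ ≤ C * ‖w‖ := by
  have hd : ∀ w ∈ Metric.ball (0 : ℂ) 1, DifferentiableAt ℂ eulerPhi w := fun w hw =>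
    differentiableOn_eulerPhi.differentiableAt (Metric.isOpen_ball.mem_nhds hw)
  have h0 : DifferentiableAt ℂ (fun w => eulerPhi w / eulerPhi (w ^ 2) ^ 2) 0 := by
    refine (hd 0 (by simp)).div (DifferentiableAt.pow ?_ 2) ?_
    · exact DifferentiableAt.comp (g := eulerPhi) 0 (hd _ (by simp)) (by fun_prop)
    · simp [eulerPhi_zero]
  have h1 := h0.isBigO_sub
  obtain ⟨C, hC, h2⟩ := h1.exists_pos
  rw [Asymptotics.isBigOWith_iff, Metric.eventually_nhds_iff] at h2
  obtain ⟨ρ, hρ, h3⟩ := h2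
  refine ⟨C, ρ / 2, hC, by positivity, fun w hw => ?_⟩
  simpa [eulerPhi_zero] using h3 (y := w) (by rw [dist_zero_right]; linarith)
theorem norm_one_add_mul_le {w : ℂ} {ρ : ℝ} (hw : ‖w‖ = ρ) (hρ : ρ < 1) :
    ‖1 + w‖ * (1 - ρ) ≤ ‖1 - w‖ * (1 + ρ) * Real.exp (-(ρ - w.re) / 8) := by
  have hρ0 : 0 ≤ ρ := hw ▸ norm_nonneg w
  have hx := abs_le.1 (hw ▸ Complex.abs_re_le_norm w)
  have hsq : w.re ^ 2 + w.im ^ 2 = ρ ^ 2 := by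
    rw [← hw, ← Complex.normSq_eq_norm_sq, Complex.normSq_apply]; ring
  have h1 : ‖1 + w‖ ^ 2 = 1 + ρ ^ 2 + 2 * w.re := by
    rw [← Complex.normSq_eq_norm_sq, Complex.normSq_apply]; simp; linarith
  have h2 : ‖1 - w‖ ^ 2 = 1 + ρ ^ 2 - 2 * w.re := by
    rw [← Complex.normSq_eq_norm_sq, Complex.normSq_apply]; simp; linarith
  set x := w.re
  refine le_of_sq_le_sq ?_ (by positivity)
  have hexp : 1 - (ρ - x) / 4 ≤ Real.exp (-(ρ - x) / 8) ^ 2 := by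
    rw [← Real.exp_nat_mul]
    have := Real.add_one_le_exp (((2 : ℕ) : ℝ) * (-(ρ - x) / 8))
    push_cast at this ⊢
    linarith
  rw [mul_pow, mul_pow, mul_pow, h1, h2]
  have hB : (1 + ρ ^ 2 - 2 * x) * (1 + ρ) ^ 2 ≤ 16 := by
    have : 1 + ρ ^ 2 - 2 * x ≤ 4 := by nlinarith
    have : (1 + ρ) ^ 2 ≤ 4 := by nlinarith
    have : 0 ≤ (1 + ρ) ^ 2 := by positivity
    nlinarith
  have hB0 : 0 ≤ (1 + ρ ^ 2 - 2 * x) * (1 + ρ) ^ 2 := by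
    have : 0 ≤ 1 + ρ ^ 2 - 2 * x := by nlinarith [sq_nonneg (1 - ρ)]
    positivity
  calc (1 + ρ ^ 2 + 2 * x) * (1 - ρ) ^ 2
      = (1 + ρ ^ 2 - 2 * x) * (1 + ρ) ^ 2 - 4 * (1 + ρ ^ 2) * (ρ - x) := by ring
    _ ≤ (1 + ρ ^ 2 - 2 * x) * (1 + ρ) ^ 2 * (1 - (ρ - x) / 4) := by
        have : 0 ≤ ρ - x := by linarith
        nlinarith [mul_nonneg (sq_nonneg ρ) this]
    _ ≤ _ := by gcongr

open Filter Topology in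
theorem tendsto_prod_overGen {q : ℂ} (hq : ‖q‖ < 1) :
    Tendsto (fun K => ∏ k ∈ Finset.range K, (1 + q ^ (k + 1)) / (1 - q ^ (k + 1))) atTop
      (𝓝 (overGen q)) := by
  have hq2 : ‖q ^ 2‖ < 1 := by
    rw [norm_pow]; exact pow_lt_one₀ (norm_nonneg _) hq two_ne_zero
  have h1 := (ModularForm.multipliable_one_sub_pow hq).hasProd.tendsto_prod_nat
  have h2 := (ModularForm.multipliable_one_sub_pow hq2).hasProd.tendsto_prod_nat
  refine (h2.div (h1.pow 2) (pow_ne_zero 2 (eulerPhi_ne_zero hq))).congr fun K => ?_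
  rw [Pi.div_apply, ← Finset.prod_pow, ← Finset.prod_div_distrib]
  refine Finset.prod_congr rfl fun k _ => ?_
  have : 1 - q ^ (k + 1) ≠ 0 := by
    rw [sub_ne_zero]
    intro h
    have := congrArg norm h
    rw [norm_one, norm_pow] at this
    exact absurd this.symm (pow_lt_one₀ (norm_nonneg _) hq (by simp)).ne
  field_simp
  ring

open Filter Topology in
theorem norm_overGen_le {q : ℂ} (hq : ‖q‖ < 1) :
    ‖overGen q‖ ≤ ‖overGen (‖q‖ : ℂ)‖ *
      Real.exp (-(‖q‖ / (1 - ‖q‖) - (q / (1 - q)).re) / 8) := by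
  set r := ‖q‖ with hr
  have hr0 : 0 ≤ r := norm_nonneg q
  have h1 := (tendsto_prod_overGen hq).norm
  have h2 := (tendsto_prod_overGen (q := (r : ℂ)) (by simpa [abs_of_nonneg hr0] using hq)).norm
  have hgeom : ∀ w : ℂ, ‖w‖ < 1 →
      Tendsto (fun K => ∑ k ∈ Finset.range K, w ^ (k + 1)) atTop (𝓝 (w / (1 - w))) := by
    intro w hw
    have := ((hasSum_geometric_of_norm_lt_one hw).mul_left w).tendsto_sum_nat
    rw [div_eq_mul_inv]
    refine this.congr fun K => Finset.sum_congr rfl fun k _ => ?_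
    ring
  have h3 := ((Complex.continuous_re.tendsto _).comp
    (hgeom (r : ℂ) (by simpa [abs_of_nonneg hr0] using hq))).sub
    ((Complex.continuous_re.tendsto _).comp (hgeom q hq))
  have hre : ((r : ℂ) / (1 - r)).re = r / (1 - r) := by
    exact_mod_cast Complex.ofReal_re (r / (1 - r))
  rw [hre] at h3
  have h4 := h2.mul ((Real.continuous_exp.tendsto _).comp (h3.neg.div_const 8))
  refine le_of_tendsto_of_tendsto' h1 h4 fun K => ?_
  simp only [Function.comp_apply, norm_prod, Complex.re_sum, ← Finset.sum_sub_distrib,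
    ← Finset.sum_neg_distrib, Finset.sum_div, Real.exp_sum, ← Finset.prod_mul_distrib]
  refine Finset.prod_le_prod (fun k _ => norm_nonneg _) fun k _ => ?_
  have hlt : r ^ (k + 1) < 1 := pow_lt_one₀ hr0 hq (by simp)
  have h5 := norm_one_add_mul_le (w := q ^ (k + 1)) (norm_pow q (k + 1)) hlt
  have e1 : ((r : ℂ) ^ (k + 1)).re = r ^ (k + 1) := by
    exact_mod_cast Complex.ofReal_re (r ^ (k + 1))
  have e2 : ‖(1 + (r : ℂ) ^ (k + 1)) / (1 - (r : ℂ) ^ (k + 1))‖ =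
      (1 + r ^ (k + 1)) / (1 - r ^ (k + 1)) := by
    have : (1 + (r : ℂ) ^ (k + 1)) / (1 - (r : ℂ) ^ (k + 1)) =
      (((1 + r ^ (k + 1)) / (1 - r ^ (k + 1)) : ℝ) : ℂ) := by push_cast; rfl
    rw [this, Complex.norm_real, Real.norm_of_nonneg]
    exact div_nonneg (by positivity) (by linarith)
  rw [e1, e2, norm_div]
  have hpos : 0 < ‖1 - q ^ (k + 1)‖ := by
    have := norm_sub_norm_le 1 (q ^ (k + 1))
    rw [norm_one, norm_pow] at this
    linarith
  rw [div_mul_eq_mul_div, div_le_div_iff₀ hpos (by linarith)]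
  exact h5.trans (le_of_eq (by ring))

theorem norm_overGen_exp_neg_le {y θ : ℝ} (hy : 0 < y) (hy' : y ≤ 1 / 2) (h1 : y ≤ |θ|)
    (h2 : |θ| ≤ π) : ‖overGen (Complex.exp (-(y + θ * Complex.I)))‖ ≤
      ‖overGen (Complex.exp (-y))‖ * Real.exp (-(1 / (96 * y))) := by
  set q := Complex.exp (-(y + θ * Complex.I)) with hq
  set r := Real.exp (-y) with hr
  have hqr : ‖q‖ = r := by rw [hq, Complex.norm_exp]; simp [hr]
  have hr1 : r < 1 := by rw [hr, Real.exp_lt_one_iff]; linarith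
  have hD : 1 - r ≤ y := by linarith [Real.add_one_le_exp (-y)]
  have h := norm_overGen_le (q := q) (by rw [hqr]; exact hr1)
  rw [hqr] at h
  have e : (r : ℂ) = Complex.exp (-y) := by rw [hr]; push_cast; rfl
  rw [e] at h
  refine h.trans ?_
  gcongr
  have hqre : q.re = r * Real.cos θ := by
    rw [hq, Complex.exp_re]; simp [hr]
  have hsq : q.re ^ 2 + q.im ^ 2 = r ^ 2 := by
    rw [← hqr, ← Complex.normSq_eq_norm_sq, Complex.normSq_apply]; ring
  have hcos : Real.cos θ ≤ 1 - 2 / π ^ 2 * θ ^ 2 := Real.cos_le_one_sub_mul_cos_sq h2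
  have hv : y ^ 2 ≤ 10 * (r * (1 - Real.cos θ)) := by
    have hr2 : 1 / 2 ≤ r := by linarith
    have hpi : 1 / 5 ≤ 2 / π ^ 2 := by
      rw [div_le_div_iff₀ (by norm_num) (by positivity)]
      nlinarith [Real.pi_lt_d2, Real.pi_pos]
    have hθ : y ^ 2 ≤ θ ^ 2 := by rw [← sq_abs θ]; gcongr
    have : 1 / 5 * y ^ 2 ≤ 1 - Real.cos θ := by
      calc 1 / 5 * y ^ 2 ≤ 2 / π ^ 2 * θ ^ 2 := by gcongr
        _ ≤ _ := by linarith
    nlinarith [mul_le_mul hr2 this (by positivity) (by positivity)]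
  have hval : r / (1 - r) - (q / (1 - q)).re = r * (1 - Real.cos θ) * (1 + r) /
      ((1 - r) * ((1 - r) ^ 2 + 2 * (r * (1 - Real.cos θ)))) := by
    have hpos : 0 < (1 - r) ^ 2 + 2 * (r * (1 - Real.cos θ)) := by
      have : 0 ≤ r * (1 - Real.cos θ) := by nlinarith
      have : 0 < 1 - r := by linarith
      positivity
    have e1 : (q / (1 - q)).re = (r * Real.cos θ - r ^ 2) /
        ((1 - r) ^ 2 + 2 * (r * (1 - Real.cos θ))) := by
      have hn : Complex.normSq (1 - q) = (1 - r) ^ 2 + 2 * (r * (1 - Real.cos θ)) := by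
        rw [Complex.normSq_apply]
        simp only [Complex.sub_re, Complex.one_re, Complex.sub_im, Complex.one_im]
        nlinarith
      rw [Complex.div_re, hn, ← add_div]
      congr 1
      simp only [Complex.sub_re, Complex.one_re, Complex.sub_im, Complex.one_im]
      nlinarith
    rw [e1]
    have h0 : 1 - r ≠ 0 := by linarith
    rw [div_sub_div _ _ h0 hpos.ne', div_eq_div_iff (mul_ne_zero h0 hpos.ne')
      (mul_ne_zero h0 hpos.ne')]
    ring
  rw [hval, neg_div, neg_le_neg_iff]
  have hr0 : 0 < r := Real.exp_pos _
  have hD0 : 0 < 1 - r := by linarith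
  set v := r * (1 - Real.cos θ)
  have hv0 : 0 < v := by nlinarith
  rw [div_div, div_le_div_iff₀ (by positivity) (by positivity)]
  have hD2 : (1 - r) ^ 2 ≤ y ^ 2 := by gcongr
  have h3 : (1 - r) * ((1 - r) ^ 2 + 2 * v) ≤ y * (12 * v) := by
    gcongr; linarith
  nlinarith [mul_pos (mul_pos hv0 hr0) hy]
theorem integral_exp_int_mul_I {k : ℤ} (hk : k ≠ 0) :
    ∫ θ in (-π)..π, Complex.exp (k * Complex.I * θ) = 0 := by
  have hk' : (k : ℂ) * Complex.I ≠ 0 := mul_ne_zero (by exact_mod_cast hk) Complex.I_ne_zero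
  rw [integral_exp_mul_complex hk', div_eq_zero_iff, sub_eq_zero]
  left
  rw [Complex.exp_eq_exp_iff_exists_int]
  exact ⟨k, by push_cast; ring⟩

theorem continuous_overGen_exp {y : ℝ} (hy : 0 < y) :
    Continuous fun θ : ℝ => overGen (Complex.exp (-(y + θ * Complex.I))) := by
  refine differentiableOn_overGen.continuousOn.comp_continuous (by fun_prop) fun θ => ?_
  rw [mem_ball_zero_iff, Complex.norm_exp, Real.exp_lt_one_iff]
  simpa using hy

theorem integral_overGen_mul_exp {y : ℝ} (hy : 0 < y) (n : ℕ) :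
    ∫ θ in (-π)..π, overGen (Complex.exp (-(y + θ * Complex.I))) *
      Complex.exp (n * (y + θ * Complex.I)) = 2 * π * pbar n := by
  set F : ℕ → ℝ → ℂ := fun m θ => (pbar m : ℂ) * Complex.exp (-(y + θ * Complex.I)) ^ m *
    Complex.exp (n * (y + θ * Complex.I)) with hF
  have hq : ∀ θ : ℝ, ‖Complex.exp (-(y + θ * Complex.I))‖ = Real.exp (-y) := by
    intro θ; rw [Complex.norm_exp]; simp
  have hr : Real.exp (-y) < 1 := by rw [Real.exp_lt_one_iff]; linarith
  have hnorm : ∀ m θ, ‖F m θ‖ = pbar m * Real.exp (-y) ^ m * Real.exp (n * y) := by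
    intro m θ
    have : ‖Complex.exp (n * (y + θ * Complex.I))‖ = Real.exp (n * y) := by
      rw [Complex.norm_exp]; simp
    simp only [hF, norm_mul, norm_pow, hq, this, Complex.norm_natCast]
  have hsum : Summable fun m => (pbar m : ℝ) * Real.exp (-y) ^ m * Real.exp (n * y) := by
    refine Summable.mul_right _ ?_
    have := (hasSum_pbar (q := (Real.exp (-y) : ℝ)) (by
      rw [Complex.norm_real, Real.norm_of_nonneg (Real.exp_pos _).le]; exact hr)).summable.norm
    refine this.congr fun m => ?_
    rw [norm_mul, norm_pow, Complex.norm_natCast, Complex.norm_real,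
      Real.norm_of_nonneg (Real.exp_pos _).le]
  have h_int := intervalIntegral.hasSum_integral_of_dominated_convergence (a := -π) (b := π)
    (μ := MeasureTheory.volume) (F := F)
    (f := fun θ => overGen (Complex.exp (-(y + θ * Complex.I))) *
      Complex.exp (n * (y + θ * Complex.I)))
    (fun m _ => pbar m * Real.exp (-y) ^ m * Real.exp (n * y))
    (fun m => Continuous.aestronglyMeasurable (by fun_prop))
    (fun m => .of_forall fun θ _ => (hnorm m θ).le) (.of_forall fun _ _ => hsum)
    intervalIntegrable_const
    (.of_forall fun θ _ => (hasSum_pbar (by rw [hq]; exact hr)).mul_right _)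
  have hval : ∀ m, ∫ θ in (-π)..π, F m θ = if m = n then 2 * (π : ℂ) * pbar n else 0 := by
    intro m
    have e : ∀ θ : ℝ, F m θ = (pbar m * Complex.exp (((n : ℤ) - (m : ℤ) : ℤ) * y)) *
        Complex.exp (((n : ℤ) - (m : ℤ) : ℤ) * Complex.I * θ) := by
      intro θ
      simp only [hF]
      rw [← Complex.exp_nat_mul, mul_assoc, mul_assoc, ← Complex.exp_add, ← Complex.exp_add]
      congr 2
      push_cast
      ring
    simp_rw [e]
    rw [intervalIntegral.integral_const_mul]
    split_ifs with h
    · subst h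
      simp
      ring
    · rw [integral_exp_int_mul_I (by omega), mul_zero]
  simp_rw [hval] at h_int
  exact h_int.unique (hasSum_ite_eq n _)

theorem exists_overGen_saddle_bound : ∃ C y₀ : ℝ, 0 < C ∧ 0 < y₀ ∧ ∀ y u x : ℝ, 0 < y → y ≤ y₀ →
    |u| ≤ 1 → x * y ^ 2 = π ^ 2 / 4 →
      ‖overGen (Complex.exp (-(y + (y * u : ℝ) * Complex.I))) *
          Complex.exp (x * (y + (y * u : ℝ) * Complex.I)) -
        (1 / 2 * √(y / π) * Real.exp (2 * (x * y)) : ℝ) *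
          (saddleAmp u * Complex.exp (-(x * y : ℝ) * saddlePhase u))‖ ≤
      1 / 2 * √(y / π) * Real.exp (2 * (x * y)) * (C * Real.exp (-(1 / y))) := by
  obtain ⟨C, ρ, hC, hρ, h⟩ := exists_norm_eulerPhi_ratio_sub_one_le
  refine ⟨2 * C, min 1 ρ, by positivity, by positivity, fun y u x hy hy0 hu hx => ?_⟩
  have hpi : (π : ℂ) ≠ 0 := by exact_mod_cast Real.pi_ne_zero
  have hy' : (y : ℂ) ≠ 0 := by exact_mod_cast hy.ne'
  have h1u := one_add_mul_I_ne_zero u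
  have hu2 : u ^ 2 ≤ 1 := by rw [← sq_abs]; exact pow_le_one₀ (abs_nonneg u) hu
  have hs : ((y : ℂ) + (y * u : ℝ) * Complex.I) = y * (1 + u * Complex.I) := by push_cast; ring
  rw [hs]
  have hre : 0 < ((y : ℂ) * (1 + u * Complex.I)).re := by rw [Complex.re_ofReal_mul]; simpa using hy
  rw [overGen_exp_neg hre]
  set s := (y : ℂ) * (1 + u * Complex.I) with hsdef
  set w := Complex.exp (-(2 * π ^ 2 / s)) with hw
  have hwn : ‖w‖ ≤ Real.exp (-(1 / y)) := by
    rw [hw, Complex.norm_exp, Real.exp_le_exp]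
    have e1 : (2 * (π : ℂ) ^ 2 / s).re = 2 * π ^ 2 / (y * (1 + u ^ 2)) := by
      have : 2 * (π : ℂ) ^ 2 / s = ((2 * π ^ 2 / y : ℝ) : ℂ) * (1 + u * Complex.I)⁻¹ := by
        rw [hsdef]; push_cast; field_simp
      rw [this, Complex.re_ofReal_mul, Complex.inv_re, Complex.normSq_apply]
      simp
      field_simp
    rw [Complex.neg_re, e1, neg_le_neg_iff, div_le_div_iff₀ hy (by positivity)]
    have hpi9 : 9 ≤ π ^ 2 := by nlinarith [Real.pi_gt_three]
    nlinarith [mul_le_mul_of_nonneg_left hu2 hy.le, mul_le_mul_of_nonneg_left hpi9 hy.le]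
  have hwρ : ‖w‖ ≤ ρ := by
    have h1 : Real.exp (-(1 / y)) ≤ y := by
      rw [Real.exp_neg, inv_le_comm₀ (Real.exp_pos _) hy, ← one_div]
      linarith [Real.add_one_le_exp (1 / y)]
    exact hwn.trans (h1.trans (hy0.trans (min_le_right _ _)))
  have hδ := (h w hwρ).trans (mul_le_mul_of_nonneg_left hwn hC.le)
  set δ := eulerPhi w / eulerPhi (w ^ 2) ^ 2 - 1 with hδdef
  have e2 : eulerPhi w / eulerPhi (w ^ 2) ^ 2 = 1 + δ := by rw [hδdef]; ring
  have e3 : (s / π) ^ (1 / 2 : ℂ) = (√(y / π) : ℝ) * saddleAmp u := by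
    have : s / π = ((y / π : ℝ) : ℂ) * (1 + u * Complex.I) := by
      rw [hsdef]; push_cast; field_simp
    rw [this, Complex.cpow_def_of_ne_zero, Complex.log_ofReal_mul (by positivity) h1u, add_mul,
      Complex.exp_add, saddleAmp, Complex.cpow_def_of_ne_zero h1u]
    · congr 1
      rw [Real.sqrt_eq_rpow, Real.rpow_def_of_pos (by positivity)]
      push_cast
      rfl
    · exact mul_ne_zero (by exact_mod_cast (by positivity : y / π ≠ 0)) h1u
  have e4 : Complex.exp (π ^ 2 / (4 * s)) * Complex.exp (x * s) =
      (Real.exp (2 * (x * y)) : ℝ) * Complex.exp (-(x * y : ℝ) * saddlePhase u) := by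
    push_cast
    rw [← Complex.exp_add, ← Complex.exp_add]
    congr 1
    have hx' : (π : ℂ) ^ 2 = 4 * (x * y ^ 2) := by
      have : (π : ℝ) ^ 2 = 4 * (x * y ^ 2) := by linarith
      exact_mod_cast this
    rw [hx', hsdef]
    unfold saddlePhase
    field_simp
    have hI := Complex.I_sq
    ring_nf
    rw [hI]
    ring
  set K : ℝ := 1 / 2 * √(y / π) * Real.exp (2 * (x * y)) with hK
  have e5 : 1 / 2 * (s / π) ^ (1 / 2 : ℂ) * Complex.exp (π ^ 2 / (4 * s)) *
      (eulerPhi w / eulerPhi (w ^ 2) ^ 2) * Complex.exp (x * s) -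
      (K : ℂ) * (saddleAmp u * Complex.exp (-(x * y : ℝ) * saddlePhase u)) =
      K * (saddleAmp u * Complex.exp (-(x * y : ℝ) * saddlePhase u) * δ) := by
    calc _ = 1 / 2 * (s / π) ^ (1 / 2 : ℂ) * (Complex.exp (π ^ 2 / (4 * s)) * Complex.exp (x * s)) *
          (eulerPhi w / eulerPhi (w ^ 2) ^ 2)
          - (K : ℂ) * (saddleAmp u * Complex.exp (-(x * y : ℝ) * saddlePhase u)) := by ring
      _ = _ := by
        rw [e2, e3, e4, hK, Complex.ofReal_mul, Complex.ofReal_mul]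
        push_cast
        ring
  rw [e5, norm_mul, Complex.norm_real, Real.norm_of_nonneg (by positivity)]
  refine mul_le_mul_of_nonneg_left ?_ (by positivity)
  rw [norm_mul, norm_mul, mul_assoc 2]
  have hexp : ‖Complex.exp (-(x * y : ℝ) * saddlePhase u)‖ ≤ 1 := by
    have hx0 : 0 < x := by
      have : 0 < x * y ^ 2 := by rw [hx]; positivity
      exact pos_of_mul_pos_left this (by positivity)
    have h1 := re_mul_saddlePhase_ge (t := (x * y : ℝ)) hu (by
      rw [Complex.ofReal_im, Complex.ofReal_re]; simp; positivity)
    rw [Complex.norm_exp, Real.exp_le_one_iff, neg_mul, Complex.neg_re]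
    simp only [Complex.ofReal_re, Complex.ofReal_im, abs_zero, sub_zero] at h1
    have : 0 ≤ u ^ 2 / 2 * (x * y) := by positivity
    linarith
  calc _ ≤ 2 * 1 * (C * Real.exp (-(1 / y))) := by
        gcongr
        exact norm_saddleAmp_le hu
    _ = _ := by ring

theorem exists_norm_pbar_sub_saddleInt_le : ∃ C y₀ : ℝ, 0 < C ∧ 0 < y₀ ∧ ∀ (y : ℝ) (n : ℕ),
    0 < y → y ≤ y₀ → n * y ^ 2 = π ^ 2 / 4 →
      ‖(2 * π * pbar n : ℂ) -
        (y * (1 / 2 * √(y / π) * Real.exp (2 * (n * y))) : ℝ) * saddleInt (n * y : ℝ)‖ ≤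
      1 / 2 * √(y / π) * Real.exp (2 * (n * y)) * (C * Real.exp (-(1 / (96 * y)))) := by
  obtain ⟨C, y₀, hC, hy₀, h⟩ := exists_overGen_saddle_bound
  refine ⟨2 * C + 2 * (π * (1 + C)), min y₀ (1 / 2), by positivity, by positivity,
    fun y n hy hyle hn => ?_⟩
  have hyy : y ≤ y₀ := hyle.trans (min_le_left _ _)
  have hy2 : y ≤ 1 / 2 := hyle.trans (min_le_right _ _)
  set K : ℝ := 1 / 2 * √(y / π) * Real.exp (2 * (n * y)) with hK
  have hK0 : 0 ≤ K := by positivity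
  set g : ℝ → ℂ := fun θ => overGen (Complex.exp (-(y + θ * Complex.I))) *
      Complex.exp (n * (y + θ * Complex.I)) with hg
  have hgc : Continuous g := (continuous_overGen_exp hy).mul (by fun_prop)
  have hgi : ∀ a b, IntervalIntegrable g MeasureTheory.volume a b :=
    fun a b => hgc.intervalIntegrable a b
  have hπ := Real.pi_gt_three
  have hsplit : (2 * π * pbar n : ℂ) =
      (∫ θ in (-π)..(-y), g θ) + (∫ θ in (-y)..y, g θ) + ∫ θ in y..π, g θ := by
    rw [intervalIntegral.integral_add_adjacent_intervals (hgi _ _) (hgi _ _),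
      intervalIntegral.integral_add_adjacent_intervals (hgi _ _) (hgi _ _)]
    exact (integral_overGen_mul_exp hy n).symm
  have hexp : Real.exp (-(1 / y)) ≤ Real.exp (-(1 / (96 * y))) := by
    rw [Real.exp_le_exp, neg_le_neg_iff]
    exact one_div_le_one_div_of_le hy (by linarith)
  set ε := Real.exp (-(1 / (96 * y))) with hε
  have hεy : Real.exp (-(1 / y)) ≤ 1 := by
    rw [Real.exp_le_one_iff]; have : 0 < 1 / y := by positivity
    linarith
  have hpeak : ‖overGen (Complex.exp (-y))‖ * Real.exp (n * y) ≤ K * (1 + C) := by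
    have h0 := h y 0 n hy hyy (by simp) hn
    rw [← hK, saddleAmp_zero] at h0
    simp only [mul_zero, Complex.ofReal_zero, zero_mul, add_zero, saddlePhase, one_mul] at h0
    simp only [ne_eq, OfNat.ofNat_ne_zero, not_false_eq_true, zero_pow, zero_div, mul_zero,
      Complex.exp_zero, mul_one] at h0
    have h1 := norm_le_norm_add_norm_sub' (overGen (Complex.exp (-y)) *
      Complex.exp ((n : ℝ) * y)) (K : ℂ)
    have h2 : ‖Complex.exp (((n : ℝ) : ℂ) * y)‖ = Real.exp (n * y) := by
      rw [Complex.norm_exp]; simp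
    rw [norm_mul, h2, Complex.norm_real, Real.norm_of_nonneg hK0] at h1
    have h3 : K * (C * Real.exp (-(1 / y))) ≤ K * (C * 1) := by gcongr
    linarith
  have hminor : ∀ θ : ℝ, y ≤ |θ| → |θ| ≤ π → ‖g θ‖ ≤ K * (1 + C) * ε := by
    intro θ h1 h2
    have h3 := norm_overGen_exp_neg_le hy hy2 h1 h2
    have h4 : ‖Complex.exp (n * (y + θ * Complex.I))‖ = Real.exp (n * y) := by
      rw [Complex.norm_exp]; simp
    calc ‖g θ‖ ≤ ‖overGen (Complex.exp (-y))‖ * ε * Real.exp (n * y) := by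
          simp only [hg, norm_mul, h4]
          gcongr
      _ = ‖overGen (Complex.exp (-y))‖ * Real.exp (n * y) * ε := by ring
      _ ≤ _ := by gcongr
  have hleft : ‖∫ θ in (-π)..(-y), g θ‖ ≤ K * (1 + C) * ε * π := by
    refine (intervalIntegral.norm_integral_le_of_norm_le_const
      (C := K * (1 + C) * ε) fun θ hθ => ?_).trans ?_
    · rw [Set.uIoc_of_le (by linarith)] at hθ
      have : θ < 0 := by linarith [hθ.2]
      exact hminor θ (by rw [abs_of_neg this]; linarith [hθ.2])
        (by rw [abs_of_neg this]; linarith [hθ.1])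
    · rw [abs_of_nonneg (by linarith)]
      gcongr
      linarith
  have hright : ‖∫ θ in y..π, g θ‖ ≤ K * (1 + C) * ε * π := by
    refine (intervalIntegral.norm_integral_le_of_norm_le_const
      (C := K * (1 + C) * ε) fun θ hθ => ?_).trans ?_
    · rw [Set.uIoc_of_le (by linarith)] at hθ
      have : 0 < θ := by linarith [hθ.1]
      exact hminor θ (by rw [abs_of_pos this]; linarith [hθ.1])
        (by rw [abs_of_pos this]; linarith [hθ.2])
    · rw [abs_of_nonneg (by linarith)]
      gcongr
      linarith
  have hmajor : ‖(∫ θ in (-y)..y, g θ) - (y * K : ℝ) * saddleInt (n * y : ℝ)‖ ≤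
      K * (2 * C * ε) := by
    have e1 : ∫ θ in (-y)..y, g θ = y * ∫ u in (-1 : ℝ)..1, g (y * u) := by
      have := intervalIntegral.smul_integral_comp_mul_left (a := -1) (b := 1) g y
      rw [mul_neg, mul_one] at this
      rw [← this, Complex.real_smul]
    have hc := continuous_saddlePhase
    have hc' := continuous_saddleAmp
    have e2 : (∫ θ in (-y)..y, g θ) - (y * K : ℝ) * saddleInt (n * y : ℝ) =
        y * ∫ u in (-1 : ℝ)..1, (g (y * u) -
          K * (saddleAmp u * Complex.exp (-(n * y : ℝ) * saddlePhase u))) := by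
      rw [intervalIntegral.integral_sub, intervalIntegral.integral_const_mul, e1, saddleInt]
      · push_cast; ring
      · exact (hgc.comp (by fun_prop)).intervalIntegrable _ _
      · exact Continuous.intervalIntegrable (by fun_prop) _ _
    rw [e2, norm_mul, Complex.norm_real, Real.norm_of_nonneg hy.le]
    have e3 := intervalIntegral.norm_integral_le_of_norm_le_const (a := -1) (b := 1)
      (C := K * (C * ε)) (f := fun u => g (y * u) -
          K * (saddleAmp u * Complex.exp (-(n * y : ℝ) * saddlePhase u))) fun u hu => by
        rw [Set.uIoc_of_le (by norm_num)] at hu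
        refine (h y u n hy hyy (abs_le.2 ⟨hu.1.le, hu.2⟩) hn).trans ?_
        rw [← hK]
        gcongr
    have e4 : |(1 : ℝ) - -1| = 2 := by norm_num
    rw [e4] at e3
    calc _ ≤ 1 * (K * (C * ε) * 2) := by
          gcongr
          linarith
      _ = _ := by ring
  rw [hsplit]
  calc _ = ‖(∫ θ in (-π)..(-y), g θ) + ((∫ θ in (-y)..y, g θ) -
          (y * K : ℝ) * saddleInt (n * y : ℝ)) + ∫ θ in y..π, g θ‖ := by congr 1; ring
    _ ≤ K * (1 + C) * ε * π + K * (2 * C * ε) + K * (1 + C) * ε * π :=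
        norm_add₃_le.trans (by gcongr)
    _ = _ := by ring

theorem norm_rpow_neg_half_differences_le {x : ℝ} (hx : 16 < x) :
    |(x + 1) ^ (-(1 / 2) : ℝ) - x ^ (-(1 / 2) : ℝ)| ≤ 16 * (x ^ (-(1 / 2) : ℝ) / x) ∧
    |(x + 2) ^ (-(1 / 2) : ℝ) - 2 * (x + 1) ^ (-(1 / 2) : ℝ) + x ^ (-(1 / 2) : ℝ)| ≤
      256 * (x ^ (-(1 / 2) : ℝ) / x ^ 2) ∧
    |(x + 3) ^ (-(1 / 2) : ℝ) - 3 * (x + 2) ^ (-(1 / 2) : ℝ) + 3 * (x + 1) ^ (-(1 / 2) : ℝ)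
      - x ^ (-(1 / 2) : ℝ)| ≤ 8192 * (x ^ (-(1 / 2) : ℝ) / x ^ 3) := by
  have hx0 : 0 < x := by linarith
  set f : ℂ → ℂ := fun z => z ^ ((-(1 / 2) : ℝ) : ℂ) with hf
  have hre : ∀ z ∈ Metric.ball (x : ℂ) (x / 2), x / 2 < z.re := by
    intro z hz
    rw [Metric.mem_ball, dist_eq_norm] at hz
    have := (Complex.abs_re_le_norm (z - x)).trans_lt hz
    rw [Complex.sub_re, Complex.ofReal_re, abs_lt] at this
    linarith
  have hd : DifferentiableOn ℂ f (Metric.ball x (x / 2)) := fun z hz =>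
    ((differentiableAt_id.cpow_const (Or.inl (by
      have := hre z hz; simp only [id]; linarith)))).differentiableWithinAt
  have hB : ∀ z ∈ Metric.ball (x : ℂ) (x / 2), ‖f z‖ ≤ 2 * x ^ (-(1 / 2) : ℝ) := by
    intro z hz
    have h1 := hre z hz
    have h2 : x / 2 ≤ ‖z‖ := h1.le.trans (Complex.re_le_norm z)
    simp only [hf]
    rw [Complex.norm_cpow_real]
    calc ‖z‖ ^ (-(1 / 2) : ℝ) ≤ (x / 4) ^ (-(1 / 2) : ℝ) :=
          Real.rpow_le_rpow_of_nonpos (by positivity) (by linarith) (by norm_num)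
      _ = 2 * x ^ (-(1 / 2) : ℝ) := by
        rw [Real.div_rpow hx0.le (by norm_num), show (4 : ℝ) = 2 ^ (2 : ℝ) by norm_num,
          ← Real.rpow_mul (by norm_num)]
        norm_num [Real.rpow_neg_one]
        ring
  obtain ⟨h1, h2, h3⟩ := norm_differences_le_of_ball (by linarith) hd hB
  have hval : ∀ k : ℝ, 0 ≤ k → f (x + (k : ℂ)) = (((x + k) ^ (-(1 / 2) : ℝ) : ℝ) : ℂ) := by
    intro k hk
    rw [Complex.ofReal_cpow (by linarith)]
    simp [hf]
  have v0 := hval 0 le_rfl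
  have v1 := hval 1 zero_le_one
  have v2 := hval 2 zero_le_two
  have v3 := hval 3 (by norm_num)
  simp only [Complex.ofReal_zero, add_zero, Complex.ofReal_one, Complex.ofReal_ofNat] at v0 v1 v2 v3
  rw [v0, v1] at h1
  rw [v0, v1, v2] at h2
  rw [v0, v1, v2, v3] at h3
  norm_cast at h1 h2 h3
  have hp : 0 < x ^ (-(1 / 2) : ℝ) := by positivity
  refine ⟨?_, ?_, ?_⟩
  · refine h1.trans (le_of_eq ?_)
    field_simp
    norm_num
  · refine h2.trans (le_of_eq ?_)
    field_simp
    norm_num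
  · refine h3.trans (le_of_eq ?_)
    field_simp
    norm_num

open Filter Topology

theorem discr_neg_of_expansion {C δ M t p1 p2 p3 r0 r1 r2 r3 a₀ a₁ a₂ a₃ : ℝ} (hC : 0 < C)
    (hδ : 0 < δ)
    (hM : M = 10 ^ 5 + 4 * C / δ + 32 * C / δ ^ 2 + 512 * C / δ ^ 3 + 8 * C) (hM1 : 1 ≤ M)
    (k1 : M ^ 2 * t ^ 2 ≤ (1 / 8) / 4) (k2 : 24 * M ^ 4 * t ^ 2 < (1 / 8) ^ 2 / 16)
    (k3 : 16 * M * t < 1 / 8) (k4 : t ≤ 1) (ht0 : 0 < t)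
    (P1 : |p1 - t ^ 2| ≤ 16 * t ^ 6) (P2 : |p2 - 2 * p1 + t ^ 2| ≤ 256 * t ^ 10)
    (P3 : |p3 - 3 * p2 + 3 * p1 - t ^ 2| ≤ 8192 * t ^ 14)
    (P3' : p3 - 3 * p2 + 3 * p1 - t ^ 2 ≤ -(15 / 8) * (1 / 16 * t ^ 14))
    (E0 : |r0| ≤ C * t ^ 3) (E1 : |r1 - r0| ≤ 4 * C / δ * t ^ 7)
    (E2 : |r2 - 2 * r1 + r0| ≤ 32 * C / δ ^ 2 * t ^ 11)
    (E3 : |r3 - 3 * r2 + 3 * r1 - r0| ≤ 512 * C / δ ^ 3 * t ^ 15)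
    (ha0 : |a₀ - (1 + π * t ^ 2 + r0)| ≤ C * t ^ 16)
    (ha1 : |a₁ - (1 + π * p1 + r1)| ≤ C * t ^ 16)
    (ha2 : |a₂ - (1 + π * p2 + r2)| ≤ C * t ^ 16)
    (ha3 : |a₃ - (1 + π * p3 + r3)| ≤ C * t ^ 16) :
    0 < a₃ ∧ 4 * (a₁ ^ 2 - a₀ * a₂) * (a₂ ^ 2 - a₁ * a₃) < (a₁ * a₂ - a₀ * a₃) ^ 2 := by
  have hpow : ∀ {i j : ℕ}, i ≤ j → t ^ j ≤ t ^ i := fun h => pow_le_pow_of_le_one ht0.le k4 h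
  have hπ3 := Real.pi_gt_three
  have hπ4 := Real.pi_lt_four
  have hπ : ∀ {r B : ℝ}, |r| ≤ B → |π * r| ≤ 4 * B := fun {r B} h => by
    rw [abs_mul, abs_of_pos Real.pi_pos]
    exact mul_le_mul hπ4.le h (abs_nonneg _) (by norm_num)
  replace P1 := abs_le.1 (hπ P1)
  replace P2 := abs_le.1 (hπ P2)
  replace P3 := abs_le.1 (hπ P3)
  rw [abs_le] at ha0 ha1 ha2 ha3 E0 E1 E2 E3
  have c1 : 0 < 4 * C / δ := by positivity
  have c2 : 0 < 32 * C / δ ^ 2 := by positivity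
  have c3 : 0 < 512 * C / δ ^ 3 := by positivity
  have b1 : |a₁ - a₀| ≤ M * t ^ 6 := by
    have h1 : 4 * C / δ * t ^ 7 ≤ 4 * C / δ * t ^ 6 := by gcongr 1; exact hpow (by norm_num)
    have h2 : C * t ^ 16 ≤ C * t ^ 6 := by gcongr 1; exact hpow (by norm_num)
    have h3 : 0 ≤ 32 * C / δ ^ 2 * t ^ 6 := by positivity
    have h4 : 0 ≤ 512 * C / δ ^ 3 * t ^ 6 := by positivity
    have h5 : 0 ≤ C * t ^ 6 := by positivity
    have h6 : 0 ≤ t ^ 6 := by positivity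
    rw [abs_le, hM]
    constructor <;> nlinarith only [P1, ha0, ha1, E1, h1, h2, h3, h4, h5, h6]
  have b2 : |a₂ - 2 * a₁ + a₀| ≤ M * t ^ 10 := by
    have h1 : 32 * C / δ ^ 2 * t ^ 11 ≤ 32 * C / δ ^ 2 * t ^ 10 := by
      gcongr 1; exact hpow (by norm_num)
    have h2 : C * t ^ 16 ≤ C * t ^ 10 := by gcongr 1; exact hpow (by norm_num)
    have h3 : 0 ≤ 4 * C / δ * t ^ 10 := by positivity
    have h4 : 0 ≤ 512 * C / δ ^ 3 * t ^ 10 := by positivity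
    have h5 : 0 ≤ C * t ^ 10 := by positivity
    have h6 : 0 ≤ t ^ 10 := by positivity
    rw [abs_le, hM]
    constructor <;> nlinarith only [P2, ha0, ha1, ha2, E2, h1, h2, h3, h4, h5, h6]
  have b3 : |a₃ - 3 * a₂ + 3 * a₁ - a₀| ≤ M * t ^ 14 := by
    have h1 : 512 * C / δ ^ 3 * t ^ 15 ≤ 512 * C / δ ^ 3 * t ^ 14 := by
      gcongr 1; exact hpow (by norm_num)
    have h2 : C * t ^ 16 ≤ C * t ^ 14 := by gcongr 1; exact hpow (by norm_num)
    have h3 : 0 ≤ 4 * C / δ * t ^ 14 := by positivity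
    have h4 : 0 ≤ 32 * C / δ ^ 2 * t ^ 14 := by positivity
    have h5 : 0 ≤ C * t ^ 14 := by positivity
    have h6 : 0 ≤ t ^ 14 := by positivity
    rw [abs_le, hM]
    constructor <;> nlinarith only [P3, ha0, ha1, ha2, ha3, E3, h1, h2, h3, h4, h5, h6]
  have b3' : 1 / 8 * t ^ 14 ≤ |a₃ - 3 * a₂ + 3 * a₁ - a₀| := by
    have hq : π * (p3 - 3 * p2 + 3 * p1 - t ^ 2) ≤ 3 * (-(15 / 8) * (1 / 16 * t ^ 14)) := by
      have h6 : 0 ≤ t ^ 14 := by positivity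
      nlinarith only [P3', hπ3, h6]
    have h1 : 512 * C / δ ^ 3 * t ^ 15 + 8 * C * t ^ 16 ≤ 1 / 8 * t ^ 14 := by
      have h2 : 8 * C * t ^ 16 ≤ 8 * C * t ^ 15 := by gcongr 1; exact hpow (by norm_num)
      have h3 : 512 * C / δ ^ 3 + 8 * C ≤ 16 * M := by linarith
      calc _ ≤ (512 * C / δ ^ 3 + 8 * C) * t * t ^ 14 := by linarith
        _ ≤ 16 * M * t * t ^ 14 := by gcongr
        _ ≤ _ := by gcongr
    rw [le_abs]
    right
    nlinarith only [hq, h1, ha0, ha1, ha2, ha3, E3, pow_pos ht0 14]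
  have hMt : M * t ≤ 1 / 128 := by linarith
  have hb : ∀ {k : ℕ} {r : ℝ}, 1 ≤ k → |r| ≤ M * t ^ k → |r| ≤ 1 / 128 := fun {k r} hk h => by
    have := hpow hk
    rw [pow_one] at this
    exact (h.trans (by gcongr)).trans hMt
  have hA : 9 / 10 ≤ a₀ ∧ a₀ ≤ 11 / 10 := by
    have h1 : t ^ 2 ≤ t := by simpa using hpow (i := 1) (j := 2) (by norm_num)
    have h3 : C * t ^ 3 ≤ C * t := by
      gcongr 1; simpa using hpow (i := 1) (j := 3) (by norm_num)
    have h16 : C * t ^ 16 ≤ C * t := by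
      gcongr 1; simpa using hpow (i := 1) (j := 16) (by norm_num)
    have hCM : 8 * C ≤ M := by linarith
    have hCt : 8 * C * t ≤ M * t := by gcongr
    have hMM : 10 ^ 5 * t ≤ M * t := by
      gcongr; linarith
    have h5 : 0 ≤ π * t ^ 2 := by positivity
    have h6 : π * t ^ 2 ≤ 4 * t := by nlinarith only [h1, hπ4, ht0, sq_nonneg t]
    constructor <;> linarith
  have q1 := abs_le.1 (hb (by norm_num) b1)
  have q2 := abs_le.1 (hb (by norm_num) b2)
  have q3 := abs_le.1 (hb (by norm_num) b3)
  refine ⟨by linarith, ?_⟩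
  have := discr_neg_of_differences hM1 (by norm_num : (0 : ℝ) < 1 / 8) ht0 k4 k1 k2
    (by linarith : 1 / 2 ≤ a₀) (by linarith) b1 b2 b3 b3'
  nlinarith only [this]

theorem eventually_discr_neg {a : ℕ → ℝ} {E : ℂ → ℂ} {C δ : ℝ} (hC : 0 < C) (hδ : 0 < δ)
    (hE : ∀ᶠ x : ℝ in atTop, DifferentiableOn ℂ E (Metric.ball x (δ * x)) ∧
      ∀ z ∈ Metric.ball (x : ℂ) (δ * x), ‖E z‖ ≤ C * x ^ (-(3 / 4) : ℝ))
    (ha : ∀ᶠ n : ℕ in atTop,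
      ‖(a n : ℂ) - (1 + (π * (n : ℝ) ^ (-(1 / 2) : ℝ) : ℝ) + E n)‖ ≤ C * (n : ℝ) ^ (-4 : ℝ)) :
    ∀ᶠ n : ℕ in atTop, 0 < a (n + 3) ∧
      4 * (a (n + 1) ^ 2 - a n * a (n + 2)) * (a (n + 2) ^ 2 - a (n + 1) * a (n + 3)) <
        (a (n + 1) * a (n + 2) - a n * a (n + 3)) ^ 2 := by
  set M : ℝ := 10 ^ 5 + 4 * C / δ + 32 * C / δ ^ 2 + 512 * C / δ ^ 3 + 8 * C with hM
  have hM1 : 1 ≤ M := by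
    have : 0 ≤ 4 * C / δ + 32 * C / δ ^ 2 + 512 * C / δ ^ 3 + 8 * C := by positivity
    rw [hM]; linarith
  have ht0 : Tendsto (fun n : ℕ => (n : ℝ) ^ (-(1 / 4) : ℝ)) atTop (𝓝 0) :=
    (tendsto_rpow_neg_atTop (by norm_num)).comp tendsto_natCast_atTop_atTop
  have hsmall : ∀ᶠ t : ℝ in 𝓝 0, M ^ 2 * t ^ 2 ≤ (1 / 8) / 4 ∧
      24 * M ^ 4 * t ^ 2 < (1 / 8) ^ 2 / 16 ∧ 16 * M * t < 1 / 8 ∧ t ≤ 1 := by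
    have h1 : ContinuousAt (fun t : ℝ => M ^ 2 * t ^ 2) 0 := by fun_prop
    have h2 : ContinuousAt (fun t : ℝ => 24 * M ^ 4 * t ^ 2) 0 := by fun_prop
    have h3 : ContinuousAt (fun t : ℝ => 16 * M * t) 0 := by fun_prop
    have h4 : ∀ᶠ t : ℝ in 𝓝 0, t ≤ 1 := Iic_mem_nhds one_pos
    filter_upwards [h1.eventually_lt continuousAt_const (by norm_num : M ^ 2 * 0 ^ 2 < (1 / 8) / 4),
      h2.eventually_lt continuousAt_const (by norm_num : 24 * M ^ 4 * 0 ^ 2 < (1 / 8) ^ 2 / 16),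
      h3.eventually_lt continuousAt_const (by norm_num : 16 * M * 0 < 1 / 8), h4]
      with t k1 k2 k3 k4
    exact ⟨k1.le, k2, k3, k4⟩
  have hnat := tendsto_natCast_atTop_atTop (R := ℝ)
  have hs1 : Tendsto (fun n : ℕ => n + 1) atTop atTop := tendsto_add_atTop_nat 1
  have hs2 : Tendsto (fun n : ℕ => n + 2) atTop atTop := tendsto_add_atTop_nat 2
  have hs3 : Tendsto (fun n : ℕ => n + 3) atTop atTop := tendsto_add_atTop_nat 3
  have hsn := ht0.eventually hsmall
  have hEn := hnat.eventually hE
  filter_upwards [hsn, hEn, ha, hs1.eventually ha, hs2.eventually ha, hs3.eventually ha,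
    hnat.eventually_gt_atTop 16, hnat.eventually_gt_atTop (8 / δ)]
    with n ht hEn ha0 ha1 ha2 ha3 hn16 hnδ
  obtain ⟨k1, k2, k3, k4⟩ := ht
  obtain ⟨hEd, hEb⟩ := hEn
  set x : ℝ := (n : ℝ) with hx
  have hx0 : 0 < x := by linarith
  set t : ℝ := x ^ (-(1 / 4) : ℝ) with ht
  have ht0 : 0 < t := by positivity
  have hxt : ∀ k : ℕ, x ^ (-(k / 4) : ℝ) = t ^ k := by
    intro k
    rw [ht, ← Real.rpow_mul_natCast hx0.le]
    congr 1
    ring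
  have hinv : x⁻¹ = t ^ 4 := by rw [← hxt 4, ← Real.rpow_neg_one]; norm_num
  have e2 : x ^ (-(1 / 2) : ℝ) = t ^ 2 := by rw [← hxt 2]; norm_num
  have e3 : x ^ (-(3 / 4) : ℝ) = t ^ 3 := by rw [← hxt 3]; norm_num
  have e14 : x ^ (-(7 / 2) : ℝ) = t ^ 14 := by rw [← hxt 14]; norm_num
  have e16 : x ^ (-4 : ℝ) = t ^ 16 := by rw [← hxt 16]; norm_num
  obtain ⟨E1, E2, E3⟩ := norm_differences_le_of_ball (R := δ * x)
    (by rwa [div_lt_iff₀' hδ] at hnδ) hEd hEb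
  obtain ⟨P1, P2, P3⟩ := norm_rpow_neg_half_differences_le hn16
  have P3' := third_difference_rpow_neg_half_le hx0
  have E0 := hEb x (Metric.mem_ball_self (by positivity))
  have hx4 : ∀ k : ℝ, 0 ≤ k → (x + k) ^ (-4 : ℝ) ≤ t ^ 16 := by
    intro k hk
    rw [← e16]
    exact Real.rpow_le_rpow_of_nonpos hx0 (by linarith) (by norm_num)
  push_cast at ha0 ha1 ha2 ha3
  rw [← hx] at ha1 ha2 ha3
  replace ha1 := ha1.trans (mul_le_mul_of_nonneg_left (hx4 1 zero_le_one) hC.le)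
  replace ha2 := ha2.trans (mul_le_mul_of_nonneg_left (hx4 2 zero_le_two) hC.le)
  replace ha3 := ha3.trans (mul_le_mul_of_nonneg_left (hx4 3 (by norm_num)) hC.le)
  rw [e3] at E0 E1 E2 E3
  rw [e16] at ha0
  rw [e2] at P1 P2 P3
  have hre : ∀ {z : ℂ} {B : ℝ}, ‖z‖ ≤ B → |z.re| ≤ B := fun h => (Complex.abs_re_le_norm _).trans h
  replace ha0 := hre ha0
  replace ha1 := hre ha1
  replace ha2 := hre ha2
  replace ha3 := hre ha3
  replace E0 := hre E0
  replace E1 := hre E1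
  replace E2 := hre E2
  replace E3 := hre E3
  have hnx : (n : ℂ) = (x : ℂ) := by rw [hx]; simp
  rw [hnx] at ha0 ha1 ha2 ha3
  rw [e2] at ha0 P3'
  have h3re : ∀ z : ℂ, (3 * z).re = 3 * z.re := fun z => by simp
  have h2re : ∀ z : ℂ, (2 * z).re = 2 * z.re := fun z => by simp
  simp only [Complex.sub_re, Complex.add_re, Complex.ofReal_re, Complex.one_re, h3re, h2re,
    Complex.re_ofReal_mul] at ha0 ha1 ha2 ha3 E0 E1 E2 E3
  have f1 : 4 * (C * t ^ 3) / (δ * x) = 4 * C / δ * t ^ 7 := by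
    rw [div_mul_eq_div_div, div_eq_mul_inv _ x, hinv]; ring
  have f2 : 32 * (C * t ^ 3) / (δ * x) ^ 2 = 32 * C / δ ^ 2 * t ^ 11 := by
    rw [mul_pow, div_mul_eq_div_div, div_eq_mul_inv _ (x ^ 2), ← inv_pow, hinv]; ring
  have f3 : 512 * (C * t ^ 3) / (δ * x) ^ 3 = 512 * C / δ ^ 3 * t ^ 15 := by
    rw [mul_pow, div_mul_eq_div_div, div_eq_mul_inv _ (x ^ 3), ← inv_pow, hinv]; ring
  have g1 : t ^ 2 / x = t ^ 6 := by rw [div_eq_mul_inv, hinv]; ring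
  have g2 : t ^ 2 / x ^ 2 = t ^ 10 := by rw [div_eq_mul_inv, ← inv_pow, hinv]; ring
  have g3 : t ^ 2 / x ^ 3 = t ^ 14 := by rw [div_eq_mul_inv, ← inv_pow, hinv]; ring
  rw [f1] at E1
  rw [f2] at E2
  rw [f3] at E3
  rw [g1] at P1
  rw [g2] at P2
  rw [g3] at P3
  have hlow : 1 / 16 * t ^ 14 ≤ (x + 3) ^ (-(7 / 2) : ℝ) := by
    have h1 : (2 * x) ^ (-(7 / 2) : ℝ) ≤ (x + 3) ^ (-(7 / 2) : ℝ) :=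
      Real.rpow_le_rpow_of_nonpos (by positivity) (by linarith) (by norm_num)
    have h2 : (2 : ℝ) ^ (-4 : ℝ) ≤ 2 ^ (-(7 / 2) : ℝ) :=
      Real.rpow_le_rpow_of_exponent_le (by norm_num) (by norm_num)
    rw [Real.mul_rpow zero_le_two hx0.le, e14] at h1
    refine le_trans ?_ h1
    gcongr
    refine le_trans ?_ h2
    norm_num
  exact discr_neg_of_expansion hC hδ hM hM1 k1 k2 k3 k4 ht0 P1 P2 P3 (P3'.trans (by linarith))
    E0 E1 E2 E3 ha0 ha1 ha2 ha3

/-- The subexponential part of `log (pbar n / n ^ α)`, as an analytic function of `n`. -/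
noncomputable def logTail (α : ℝ) (z : ℂ) : ℂ :=
  -(3 / 4 + α) * Complex.log z - 7 / 2 * Real.log 2 +
    Complex.log (saddleInt (π / 2 * z ^ (1 / 2 : ℂ)))

/-- The analytic function approximating `rseq α`. -/
noncomputable def rseqModel (α : ℝ) (z : ℂ) : ℂ :=
  Complex.exp (π * z ^ (-(1 / 2) : ℂ) + logTail α z / z)

theorem norm_log_le (z : ℂ) : ‖Complex.log z‖ ≤ |Real.log ‖z‖| + π := by
  refine (Complex.norm_le_abs_re_add_abs_im _).trans ?_
  rw [Complex.log_re, Complex.log_im]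
  gcongr
  exact Complex.abs_arg_le_pi z

theorem re_cpow_half_nonneg (z : ℂ) : 0 ≤ (z ^ (1 / 2 : ℂ)).re := by
  rcases eq_or_ne z 0 with rfl | hz
  · simp
  rw [Complex.cpow_def_of_ne_zero hz, Complex.exp_re]
  refine mul_nonneg (Real.exp_pos _).le (Real.cos_nonneg_of_mem_Icc ?_)
  have h : (Complex.log z * (1 / 2 : ℂ)).im = z.arg / 2 := by
    rw [show (1 / 2 : ℂ) = ((1 / 2 : ℝ) : ℂ) by push_cast; rfl, Complex.im_mul_ofReal,
      Complex.log_im]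
    ring
  rw [h]
  constructor <;> linarith [Complex.neg_pi_lt_arg z, Complex.arg_le_pi z]

theorem norm_cpow_half_sub_le {z : ℂ} {x : ℝ} (hx : 0 < x) (hz : ‖z - x‖ ≤ x / 200) :
    ‖z ^ (1 / 2 : ℂ) - √x‖ ≤ √x / 200 := by
  have hs : 0 < √x := Real.sqrt_pos.2 hx
  have hsq : (√x : ℝ) * √x = x := Real.mul_self_sqrt hx.le
  have h1 : (z ^ (1 / 2 : ℂ) - √x) * (z ^ (1 / 2 : ℂ) + √x) = z - x := by
    have h2 : (z ^ (1 / 2 : ℂ)) ^ 2 = z := by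
      have := Complex.cpow_nat_inv_pow z two_ne_zero
      rwa [Nat.cast_ofNat, ← one_div] at this
    have h3 : ((√x : ℝ) : ℂ) * (√x : ℝ) = x := by exact_mod_cast hsq
    linear_combination h2 - h3
  have h2 : √x ≤ ‖z ^ (1 / 2 : ℂ) + √x‖ := by
    refine le_trans ?_ (Complex.re_le_norm _)
    simpa using re_cpow_half_nonneg z
  have h3 : ‖z ^ (1 / 2 : ℂ) - √x‖ * √x ≤ √x / 200 * √x :=
    calc _ ≤ ‖z ^ (1 / 2 : ℂ) - √x‖ * ‖z ^ (1 / 2 : ℂ) + √x‖ := by gcongr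
      _ = ‖z - x‖ := by rw [← norm_mul, h1]
      _ ≤ _ := hz.trans_eq (by rw [div_mul_eq_mul_div, hsq])
  exact le_of_mul_le_mul_right h3 hs

theorem eventually_le_re_saddleInt_sqrt :
    ∀ᶠ x : ℝ in atTop, ∀ z : ℂ, ‖z - x‖ ≤ x / 200 →
      1 / 2 * x⁻¹ ≤ (saddleInt (π / 2 * z ^ (1 / 2 : ℂ))).re ∧
        ‖saddleInt (π / 2 * z ^ (1 / 2 : ℂ))‖ ≤ 5 := by
  have hT : Tendsto (fun x : ℝ => π / 2 * √x) atTop atTop :=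
    Real.tendsto_sqrt_atTop.const_mul_atTop (by positivity)
  filter_upwards [hT.eventually eventually_le_re_saddleInt, eventually_gt_atTop 4]
    with x h hx z hz
  have hx0 : 0 < x := by linarith
  have h1 : ‖(π / 2 * z ^ (1 / 2 : ℂ) : ℂ) - (π / 2 * √x : ℝ)‖ ≤ π / 2 * √x / 200 := by
    have : (π / 2 * z ^ (1 / 2 : ℂ) : ℂ) - (π / 2 * √x : ℝ) =
        (π / 2 : ℝ) * (z ^ (1 / 2 : ℂ) - √x) := by push_cast; ring
    rw [this, norm_mul, Complex.norm_real, Real.norm_of_nonneg (by positivity), mul_div_assoc]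
    gcongr
    exact norm_cpow_half_sub_le hx0 hz
  obtain ⟨h2, h3⟩ := h _ h1
  refine ⟨le_trans ?_ h2, h3⟩
  have hs : 2 ≤ √x := Real.le_sqrt_of_sq_le (by linarith)
  have hsq : √x * √x = x := Real.mul_self_sqrt hx0.le
  have hle : π / 2 * √x ≤ x := by nlinarith [Real.pi_lt_four]
  gcongr
  calc x⁻¹ = x ^ (-1 : ℝ) := (Real.rpow_neg_one x).symm
    _ ≤ x ^ (-(1 / 2) : ℝ) := Real.rpow_le_rpow_of_exponent_le (by linarith) (by norm_num)
    _ ≤ _ := Real.rpow_le_rpow_of_nonpos (by positivity) hle (by norm_num)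

theorem eventually_norm_logTail_le (α : ℝ) (hα : 0 ≤ α) :
    ∀ᶠ x : ℝ in atTop, ∀ z : ℂ, ‖z - x‖ ≤ x / 200 → ‖logTail α z‖ ≤ x ^ (1 / 4 : ℝ) := by
  have hA : 0 < (10 + 3 * α)⁻¹ := by positivity
  filter_upwards [eventually_le_re_saddleInt_sqrt, eventually_gt_atTop 4,
    Real.tendsto_log_atTop.eventually_gt_atTop 4,
    (isLittleO_log_rpow_atTop (by norm_num : (0 : ℝ) < 1 / 4)).def hA] with x h hx hl ho z hz
  have hx0 : 0 < x := by linarith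
  obtain ⟨h1, h2⟩ := h z hz
  have hπ := Real.pi_lt_four
  have hb1 := norm_le_norm_add_norm_sub' z (x : ℂ)
  have hb2 := norm_le_norm_add_norm_sub (z : ℂ) (x : ℂ)
  rw [Complex.norm_real, Real.norm_of_nonneg hx0.le] at hb1 hb2
  have hlog2 : Real.log 2 ≤ 1 := Real.log_two_lt_d9.le.trans (by norm_num)
  have hlog2' : 0 ≤ Real.log 2 := Real.log_nonneg one_le_two
  have hz1 : |Real.log ‖z‖| ≤ 5 / 4 * Real.log x := by
    rw [abs_le]
    constructor
    · have : 0 ≤ Real.log ‖z‖ := Real.log_nonneg (by linarith)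
      linarith
    · have : Real.log ‖z‖ ≤ Real.log (2 * x) := Real.log_le_log (by linarith) (by linarith)
      rw [Real.log_mul two_ne_zero hx0.ne'] at this
      linarith
  set S := saddleInt (π / 2 * z ^ (1 / 2 : ℂ)) with hS
  have hz2 : |Real.log ‖S‖| ≤ 5 / 4 * Real.log x := by
    have h3 : 1 / 2 * x⁻¹ ≤ ‖S‖ := h1.trans (Complex.re_le_norm _)
    rw [abs_le]
    constructor
    · have := Real.log_le_log (by positivity) h3
      rw [Real.log_mul (by norm_num) (by positivity), Real.log_inv, one_div, Real.log_inv] at this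
      linarith
    · have := Real.log_le_log (lt_of_lt_of_le (by positivity) h3) h2
      have h5 : Real.log 5 ≤ 4 := (Real.log_le_sub_one_of_pos (by norm_num)).trans (by norm_num)
      linarith
  have n1 : ‖(-(3 / 4 + α) : ℂ)‖ = 3 / 4 + α := by
    rw [norm_neg, show (3 / 4 + α : ℂ) = ((3 / 4 + α : ℝ) : ℂ) by push_cast; rfl,
      Complex.norm_real, Real.norm_of_nonneg (by positivity)]
  have n2 : ‖(7 / 2 * Real.log 2 : ℂ)‖ = 7 / 2 * Real.log 2 := by
    rw [show (7 / 2 * Real.log 2 : ℂ) = ((7 / 2 * Real.log 2 : ℝ) : ℂ) by push_cast; rfl,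
      Complex.norm_real, Real.norm_of_nonneg (by positivity)]
  have n3 : ‖logTail α z‖ ≤ (3 / 4 + α) * (5 / 4 * Real.log x + π) + 7 / 2 * Real.log 2 +
      (5 / 4 * Real.log x + π) := by
    refine (norm_add_le _ _).trans (add_le_add ((norm_sub_le _ _).trans (add_le_add ?_ n2.le))
      ((norm_log_le _).trans (by gcongr)))
    rw [norm_mul, n1]
    gcongr
    exact (norm_log_le _).trans (by gcongr)
  rw [Real.norm_of_nonneg (by linarith), Real.norm_of_nonneg (by positivity),
    inv_mul_eq_div, le_div_iff₀ (by positivity)] at ho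
  have n4 : 5 / 4 * Real.log x + π ≤ 9 / 4 * Real.log x := by linarith
  have n5 : (3 / 4 + α) * (5 / 4 * Real.log x + π) ≤ (3 / 4 + α) * (9 / 4 * Real.log x) := by
    gcongr
  have n6 : 0 ≤ α * Real.log x := mul_nonneg hα (by linarith)
  nlinarith only [n3, n4, n5, n6, ho, hlog2, hl]

theorem eventually_norm_rseqModel_sub_le (α : ℝ) (hα : 0 ≤ α) :
    ∀ᶠ x : ℝ in atTop,
      DifferentiableOn ℂ (fun z => rseqModel α z - 1 - π * z ^ (-(1 / 2) : ℂ))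
        (Metric.ball x (1 / 200 * x)) ∧
      ∀ z ∈ Metric.ball (x : ℂ) (1 / 200 * x),
        ‖rseqModel α z - 1 - π * z ^ (-(1 / 2) : ℂ)‖ ≤ 110 * x ^ (-(3 / 4) : ℝ) := by
  filter_upwards [eventually_le_re_saddleInt_sqrt, eventually_norm_logTail_le α hα,
    eventually_gt_atTop 100] with x h ht hx
  have hx0 : 0 < x := by linarith
  have hball : ∀ z ∈ Metric.ball (x : ℂ) (1 / 200 * x), ‖z - x‖ ≤ x / 200 := by
    intro z hz
    rw [Metric.mem_ball, dist_eq_norm] at hz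
    linarith
  have hslit : ∀ z ∈ Metric.ball (x : ℂ) (1 / 200 * x), z ∈ Complex.slitPlane := by
    intro z hz
    left
    have := (Complex.abs_re_le_norm (z - x)).trans (hball z hz)
    rw [Complex.sub_re, Complex.ofReal_re, abs_le] at this
    linarith
  refine ⟨fun z hz => DifferentiableAt.differentiableWithinAt ?_, fun z hz => ?_⟩
  · have hs := hslit z hz
    have hS : saddleInt (π / 2 * z ^ (1 / 2 : ℂ)) ∈ Complex.slitPlane :=
      Or.inl (lt_of_lt_of_le (by positivity) (h z (hball z hz)).1)
    have d1 : ∀ c : ℂ, DifferentiableAt ℂ (fun z : ℂ => z ^ c) z :=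
      fun c => differentiableAt_id.cpow_const hs
    have d2 : DifferentiableAt ℂ (logTail α) z := by
      unfold logTail
      refine (((Complex.differentiableAt_log hs).const_mul _).sub_const _).add ?_
      exact ((differentiable_saddleInt _).comp z ((d1 _).const_mul _)).clog hS
    have d3 : DifferentiableAt ℂ (rseqModel α) z := by
      unfold rseqModel
      exact (((d1 _).const_mul _).add (d2.div differentiableAt_id
        (Complex.slitPlane_ne_zero hs))).cexp
    exact (d3.sub_const _).sub ((d1 _).const_mul _)
  · have hzb := hball z hz
    have hzn : x / 2 ≤ ‖z‖ := by
      have := norm_le_norm_add_norm_sub (z : ℂ) (x : ℂ)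
      rw [Complex.norm_real, Real.norm_of_nonneg hx0.le] at this
      linarith
    have p1 : x ^ (-(1 / 2) : ℝ) ≤ 1 / 10 := by
      rw [Real.rpow_neg hx0.le, ← Real.sqrt_eq_rpow, ← one_div]
      exact one_div_le_one_div_of_le (by norm_num) (Real.le_sqrt_of_sq_le (by linarith))
    have p0 : 0 < x ^ (-(1 / 2) : ℝ) := by positivity
    have p2 : x ^ (-(3 / 4) : ℝ) ≤ x ^ (-(1 / 2) : ℝ) :=
      Real.rpow_le_rpow_of_exponent_le (by linarith) (by norm_num)
    have p3 : (x ^ (-(1 / 2) : ℝ)) ^ 2 ≤ x ^ (-(3 / 4) : ℝ) := by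
      rw [← Real.rpow_mul_natCast hx0.le]
      exact Real.rpow_le_rpow_of_exponent_le (by linarith) (by norm_num)
    have w1 : ‖(π : ℂ) * z ^ (-(1 / 2) : ℂ)‖ ≤ 8 * x ^ (-(1 / 2) : ℝ) := by
      rw [show (-(1 / 2) : ℂ) = ((-(1 / 2) : ℝ) : ℂ) by push_cast; rfl, norm_mul,
        Complex.norm_cpow_real, Complex.norm_real, Real.norm_of_nonneg Real.pi_pos.le]
      have : ‖z‖ ^ (-(1 / 2) : ℝ) ≤ 2 * x ^ (-(1 / 2) : ℝ) := by
        calc ‖z‖ ^ (-(1 / 2) : ℝ) ≤ (x / 4) ^ (-(1 / 2) : ℝ) :=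
              Real.rpow_le_rpow_of_nonpos (by positivity) (by linarith) (by norm_num)
          _ = 2 * x ^ (-(1 / 2) : ℝ) := by
            rw [Real.div_rpow hx0.le (by norm_num), show (4 : ℝ) = 2 ^ (2 : ℝ) by norm_num,
              ← Real.rpow_mul (by norm_num)]
            norm_num [Real.rpow_neg_one]
            ring
      calc _ ≤ 4 * (2 * x ^ (-(1 / 2) : ℝ)) := by
            gcongr
            exact Real.pi_lt_four.le
        _ = _ := by ring
    have w2 : ‖logTail α z / z‖ ≤ 2 * x ^ (-(3 / 4) : ℝ) := by
      rw [norm_div, div_le_iff₀ (by linarith)]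
      have e : x ^ (1 / 4 : ℝ) = 2 * x ^ (-(3 / 4) : ℝ) * (x / 2) := by
        rw [show (1 / 4 : ℝ) = -(3 / 4) + 1 by norm_num, Real.rpow_add_one hx0.ne']
        ring
      refine (ht z hzb).trans (e.le.trans ?_)
      gcongr
    set W := (π : ℂ) * z ^ (-(1 / 2) : ℂ) + logTail α z / z with hW
    have w3 : ‖W‖ ≤ 10 * x ^ (-(1 / 2) : ℝ) := (norm_add_le _ _).trans (by linarith)
    have w4 := Complex.norm_exp_sub_one_sub_id_le (x := W) (by linarith)
    have e : rseqModel α z - 1 - π * z ^ (-(1 / 2) : ℂ) =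
        (Complex.exp W - 1 - W) + logTail α z / z := by
      rw [rseqModel, ← hW, hW]; ring
    rw [e]
    have w5 : ‖W‖ ^ 2 ≤ 100 * (x ^ (-(1 / 2) : ℝ)) ^ 2 :=
      (pow_le_pow_left₀ (norm_nonneg _) w3 2).trans_eq (by ring)
    refine (norm_add_le _ _).trans ?_
    have : 0 < x ^ (-(3 / 4) : ℝ) := by positivity
    linarith

theorem norm_log_sub_log_le {m : ℝ} (hm : 0 < m) {z w : ℂ} (hz : m ≤ z.re) (hw : m ≤ w.re) :
    ‖Complex.log z - Complex.log w‖ ≤ m⁻¹ * ‖z - w‖ := by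
  have hconv : Convex ℝ {z : ℂ | m ≤ z.re} := convex_halfSpace_re_ge m
  refine hconv.norm_image_sub_le_of_norm_hasDerivWithin_le (f := Complex.log)
    (f' := fun z => z⁻¹) (fun v hv => ?_) (fun v hv => ?_) hw hz
  · exact (Complex.hasDerivAt_log (Or.inl (hm.trans_le hv))).hasDerivWithinAt
  · rw [norm_inv]
    exact inv_anti₀ hm (le_trans hv (Complex.re_le_norm v))

theorem eventually_norm_pbar_div_sub_saddleInt_le :
    ∀ᶠ n : ℕ in atTop,
      ‖((pbar n / (1 / 4 * (2 * √n) ^ (-(3 / 2) : ℝ) * Real.exp (π * √n)) : ℝ) : ℂ) -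
        saddleInt (π / 2 * (n : ℂ) ^ (1 / 2 : ℂ))‖ ≤ (n : ℝ) ^ (-5 : ℝ) := by
  obtain ⟨C, y₀, hC, hy₀, h⟩ := exists_norm_pbar_sub_saddleInt_le
  have hv : Tendsto (fun n : ℕ => √(n : ℝ)) atTop atTop :=
    Real.tendsto_sqrt_atTop.comp tendsto_natCast_atTop_atTop
  have hdec := (isLittleO_exp_neg_mul_rpow_atTop (a := 1 / (48 * π)) (by positivity) (-11)).def
    (c := π / (2 * C)) (by positivity)
  filter_upwards [hv.eventually hdec, hv.eventually_gt_atTop (π / (2 * y₀)),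
    eventually_gt_atTop 0] with n hd hn hn0
  have hnR : (0 : ℝ) < n := by exact_mod_cast hn0
  set v := √(n : ℝ) with hvdef
  have hv0 : 0 < v := Real.sqrt_pos.2 hnR
  have hvv : v ^ 2 = n := Real.sq_sqrt hnR.le
  set y := π / (2 * v) with hy
  have hy0 : 0 < y := by positivity
  have hyle : y ≤ y₀ := by
    rw [div_lt_iff₀ (by positivity)] at hn
    rw [hy, div_le_iff₀ (by positivity)]
    linarith
  have hny : n * y ^ 2 = π ^ 2 / 4 := by rw [hy, ← hvv]; field_simp; norm_num
  have hny1 : n * y = π / 2 * v := by rw [hy, ← hvv]; field_simp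
  have h1 := h y n hy0 hyle hny
  set K := 1 / 2 * √(y / π) * Real.exp (2 * (n * y)) with hK
  have hK0 : 0 < K := by positivity
  have hcst : 1 / 4 * (2 * v) ^ (-(3 / 2) : ℝ) * Real.exp (π * v) = y * K / (2 * π) := by
    rw [hK, hny1, show 2 * (π / 2 * v) = π * v by ring]
    have : √(y / π) = (2 * v) ^ (-(1 / 2) : ℝ) := by
      rw [Real.rpow_neg (by positivity), ← Real.sqrt_eq_rpow, ← Real.sqrt_inv]
      congr 1
      rw [hy]
      field_simp
    rw [this, show (-(3 / 2) : ℝ) = -(1 / 2) - 1 by norm_num, Real.rpow_sub_one (by positivity), hy]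
    field_simp
    norm_num
  have hT : (π / 2 * (n : ℂ) ^ (1 / 2 : ℂ) : ℂ) = ((n * y : ℝ) : ℂ) := by
    rw [hny1, hvdef, Real.sqrt_eq_rpow]
    push_cast [Complex.ofReal_cpow hnR.le]
    rfl
  rw [hcst, hT]
  have e1 : ((pbar n / (y * K / (2 * π)) : ℝ) : ℂ) - saddleInt (n * y : ℝ) =
      ((y * K : ℝ) : ℂ)⁻¹ * ((2 * π * pbar n : ℂ) - (y * K : ℝ) * saddleInt (n * y : ℝ)) := by
    have : ((y * K : ℝ) : ℂ) ≠ 0 := by exact_mod_cast (by positivity : y * K ≠ 0)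
    have hpi : (π : ℂ) ≠ 0 := by exact_mod_cast Real.pi_ne_zero
    push_cast at this ⊢
    obtain ⟨_, _⟩ := mul_ne_zero_iff.1 this
    field_simp
  rw [e1, norm_mul, norm_inv, Complex.norm_real, Real.norm_of_nonneg (by positivity)]
  rw [Real.norm_of_nonneg (Real.exp_pos _).le, Real.norm_of_nonneg (by positivity)] at hd
  have e2 : Real.exp (-(1 / (96 * y))) = Real.exp (-(1 / (48 * π)) * v) := by
    congr 1
    rw [hy]
    field_simp
    norm_num
  have e3 : (n : ℝ) ^ (-5 : ℝ) = v ^ (-11 : ℝ) * v := by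
    rw [← hvv, ← Real.rpow_natCast_mul hv0.le, ← Real.rpow_add_one hv0.ne']
    norm_num
  calc _ ≤ (y * K)⁻¹ * (K * (C * Real.exp (-(1 / (96 * y))))) := by gcongr
    _ = 2 * C / π * v * Real.exp (-(1 / (48 * π)) * v) := by
      rw [e2, hy]
      field_simp
    _ ≤ 2 * C / π * v * (π / (2 * C) * v ^ (-11 : ℝ)) := by gcongr
    _ = _ := by rw [e3]; field_simp

theorem eventually_norm_rseq_sub_rseqModel_le (α : ℝ) (hα : 0 ≤ α) :
    ∀ᶠ n : ℕ in atTop, ‖(rseq α n : ℂ) - rseqModel α n‖ ≤ 32 * (n : ℝ) ^ (-4 : ℝ) := by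
  have hnat := tendsto_natCast_atTop_atTop (R := ℝ)
  filter_upwards [eventually_norm_pbar_div_sub_saddleInt_le,
    hnat.eventually eventually_le_re_saddleInt_sqrt,
    hnat.eventually (eventually_norm_logTail_le α hα), hnat.eventually_gt_atTop 100]
    with n hJ hS hL hn
  set x : ℝ := (n : ℝ) with hx
  have hnx : (n : ℂ) = (x : ℂ) := by rw [hx]; simp
  have hx0 : 0 < x := by linarith
  have hxx : ‖(x : ℂ) - x‖ ≤ x / 200 := by rw [sub_self, norm_zero]; positivity
  rw [hnx] at hJ ⊢
  obtain ⟨hS1, -⟩ := hS x hxx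
  replace hL := hL x hxx
  have r4 : x ^ (-4 : ℝ) = x⁻¹ ^ 4 := by
    rw [Real.rpow_neg hx0.le, inv_pow]; norm_cast
  have r5 : x ^ (-5 : ℝ) = x⁻¹ ^ 5 := by
    rw [Real.rpow_neg hx0.le, inv_pow]; norm_cast
  have hi0 : 0 < x⁻¹ := by positivity
  have hi : x⁻¹ ≤ 1 / 100 := by
    rw [← one_div]; exact one_div_le_one_div_of_le (by norm_num) hn.le
  set cst : ℝ := 1 / 4 * (2 * √x) ^ (-(3 / 2) : ℝ) * Real.exp (π * √x) with hcst
  have hcst0 : 0 < cst := by positivity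
  set J : ℝ := pbar n / cst with hJdef
  set S := saddleInt (π / 2 * (x : ℂ) ^ (1 / 2 : ℂ)) with hSdef
  rw [r5] at hJ
  have hi5 : x⁻¹ ^ 5 ≤ 1 / 4 * x⁻¹ := by
    have : x⁻¹ ^ 4 ≤ 1 := pow_le_one₀ hi0.le (by linarith)
    have h3 : x⁻¹ ^ 4 ≤ x⁻¹ ^ 1 := pow_le_pow_of_le_one hi0.le (by linarith) (by norm_num)
    nlinarith only [h3, hi0, hi]
  have hJ1 : 1 / 4 * x⁻¹ ≤ (J : ℂ).re := by
    have := (Complex.abs_re_le_norm _).trans hJ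
    rw [Complex.sub_re, abs_le] at this
    linarith
  have hlog := norm_log_sub_log_le (by positivity) hJ1 (by linarith : 1 / 4 * x⁻¹ ≤ S.re)
  have hJ0 : 0 < J := lt_of_lt_of_le (by positivity) hJ1
  replace hlog : ‖Complex.log J - Complex.log S‖ ≤ 4 * x⁻¹ ^ 4 := by
    refine hlog.trans ((mul_le_mul_of_nonneg_left hJ (by positivity)).trans_eq ?_)
    field_simp
  have hp0 : 0 < (pbar n : ℝ) := by
    have : (pbar n : ℝ) = cst * J := by rw [hJdef]; field_simp
    rw [this]; positivity
  have hlogcst : Real.log cst = π * √x - 3 / 4 * Real.log x - 7 / 2 * Real.log 2 := by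
    rw [hcst, Real.log_mul (by positivity) (by positivity), Real.log_mul (by positivity)
      (by positivity), Real.log_exp, Real.log_rpow (by positivity), Real.log_mul (by positivity)
      (by positivity), Real.log_sqrt hx0.le, one_div, Real.log_inv,
      show (4 : ℝ) = 2 ^ 2 by norm_num, Real.log_pow]
    push_cast
    ring
  have hrseq : rseq α n = Real.exp ((π * √x - (3 / 4 + α) * Real.log x - 7 / 2 * Real.log 2 +
      Real.log J) * x⁻¹) := by
    rw [rseq, ← hx, Real.rpow_def_of_pos (by positivity), Real.log_div hp0.ne' (by positivity),
      Real.log_rpow hx0, show (pbar n : ℝ) = cst * J by rw [hJdef]; field_simp,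
      Real.log_mul hcst0.ne' hJ0.ne', hlogcst]
    congr 1
    ring
  set W := (π : ℂ) * (x : ℂ) ^ (-(1 / 2) : ℂ) + logTail α x / x with hW
  set η := (Complex.log J - Complex.log S) / x with hη
  have hW' : (rseq α n : ℂ) = Complex.exp W * Complex.exp η := by
    rw [hrseq, ← Complex.exp_add, Complex.ofReal_exp]
    congr 1
    have hsq : ((√x : ℝ) : ℂ) * (x : ℂ)⁻¹ = (x : ℂ) ^ (-(1 / 2) : ℂ) := by
      have : √x * x⁻¹ = x ^ (-(1 / 2) : ℝ) := by
        rw [Real.sqrt_eq_rpow, ← Real.rpow_neg_one x, ← Real.rpow_add hx0]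
        norm_num
      rw [show (-(1 / 2) : ℂ) = ((-(1 / 2) : ℝ) : ℂ) by push_cast; rfl,
        ← Complex.ofReal_cpow hx0.le, ← this]
      push_cast
      rfl
    rw [hW, hη, logTail, ← hSdef, ← hsq]
    push_cast
    rw [Complex.ofReal_log hx0.le, Complex.ofReal_log hJ0.le]
    ring
  have hWn : ‖W‖ ≤ 1 := by
    have hq : x ^ (-(1 / 2) : ℝ) ≤ 1 / 10 := by
      rw [Real.rpow_neg hx0.le, ← Real.sqrt_eq_rpow, ← one_div]
      exact one_div_le_one_div_of_le (by norm_num) (Real.le_sqrt_of_sq_le (by linarith))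
    have h1 : ‖(π : ℂ) * (x : ℂ) ^ (-(1 / 2) : ℂ)‖ ≤ 4 * (1 / 10) := by
      rw [show (-(1 / 2) : ℂ) = ((-(1 / 2) : ℝ) : ℂ) by push_cast; rfl,
        ← Complex.ofReal_cpow hx0.le, norm_mul, Complex.norm_real, Complex.norm_real,
        Real.norm_of_nonneg Real.pi_pos.le, Real.norm_of_nonneg (by positivity)]
      gcongr
      exact Real.pi_lt_four.le
    have h2 : ‖logTail α x / x‖ ≤ 1 / 10 := by
      rw [norm_div, Complex.norm_real, Real.norm_of_nonneg hx0.le]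
      calc _ ≤ x ^ (1 / 4 : ℝ) / x := by gcongr
        _ = x ^ (-(3 / 4) : ℝ) := by rw [← Real.rpow_sub_one hx0.ne']; norm_num
        _ ≤ x ^ (-(1 / 2) : ℝ) := Real.rpow_le_rpow_of_exponent_le (by linarith) (by norm_num)
        _ ≤ _ := hq
    exact (norm_add_le _ _).trans (by linarith)
  have hηn : ‖η‖ ≤ 4 * x⁻¹ ^ 4 := by
    rw [hη, norm_div, Complex.norm_real, Real.norm_of_nonneg hx0.le]
    exact (div_le_self (norm_nonneg _) (by linarith)).trans hlog
  have hη1 : ‖η‖ ≤ 1 := by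
    have : x⁻¹ ^ 4 ≤ x⁻¹ ^ 1 := pow_le_pow_of_le_one hi0.le (by linarith) (by norm_num)
    linarith
  have hexpW : ‖Complex.exp W‖ ≤ 4 := by
    rw [Complex.norm_exp]
    have : Real.exp W.re ≤ Real.exp 1 :=
      Real.exp_le_exp.2 ((Complex.re_le_norm W).trans hWn)
    linarith [Real.exp_one_lt_d9]
  have e : (rseq α n : ℂ) - rseqModel α x = Complex.exp W * (Complex.exp η - 1) := by
    rw [hW', rseqModel, ← hW]; ring
  rw [e, norm_mul, r4]
  calc _ ≤ 4 * (2 * ‖η‖) := by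
        gcongr
        exact Complex.norm_exp_sub_one_le hη1
    _ ≤ 4 * (2 * (4 * x⁻¹ ^ 4)) := by gcongr
    _ = _ := by ring

theorem jensenCubic_succ (α : ℝ) (n : ℕ) (w : ℂ) :
    jensenCubic α (n + 1) w = (rseq α n : ℂ) + 3 * (rseq α (n + 1) : ℝ) * w +
      3 * (rseq α (n + 2) : ℝ) * w ^ 2 + (rseq α (n + 3) : ℝ) * w ^ 3 := by
  simp [jensenCubic, Finset.sum_range_succ, Nat.choose]

theorem stmt6 (α : ℝ) (hα : 0 ≤ α) :
    ∃ NT : ℕ, 0 < NT ∧ ∀ n : ℕ, NT ≤ n →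
      ∃ (x : ℝ) (z : ℂ), z.im ≠ 0 ∧
        ∀ w : ℂ, jensenCubic α n w = 0 ↔ (w = (x : ℂ) ∨ w = z ∨ w = (starRingEnd ℂ) z) := by
  have h1 : ∀ᶠ n : ℕ in atTop, ‖(rseq α n : ℂ) - (1 + (π * (n : ℝ) ^ (-(1 / 2) : ℝ) : ℝ) +
      (rseqModel α n - 1 - π * (n : ℂ) ^ (-(1 / 2) : ℂ)))‖ ≤ 110 * (n : ℝ) ^ (-4 : ℝ) := by
    filter_upwards [eventually_norm_rseq_sub_rseqModel_le α hα] with n hn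
    have e : (n : ℂ) ^ (-(1 / 2) : ℂ) = (((n : ℝ) ^ (-(1 / 2) : ℝ) : ℝ) : ℂ) := by
      rw [Complex.ofReal_cpow n.cast_nonneg]
      push_cast
      rfl
    have e' : (rseq α n : ℂ) - (1 + (π * (n : ℝ) ^ (-(1 / 2) : ℝ) : ℝ) +
        (rseqModel α n - 1 - π * (n : ℂ) ^ (-(1 / 2) : ℂ))) = rseq α n - rseqModel α n := by
      rw [e]
      push_cast
      ring
    rw [e']
    refine hn.trans ?_
    gcongr
    norm_num
  obtain ⟨N, hN⟩ := eventually_atTop.1 (eventually_discr_neg (by norm_num) (by norm_num)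
    (eventually_norm_rseqModel_sub_le α hα) h1)
  refine ⟨N + 1, N.succ_pos, fun n hn => ?_⟩
  obtain ⟨m, rfl⟩ : ∃ m, n = m + 1 := ⟨n - 1, by omega⟩
  obtain ⟨h3, hD⟩ := hN m (by omega)
  obtain ⟨x, z, hz, h⟩ := cubic_roots_of_discr_neg h3 hD
  exact ⟨x, z, hz, fun w => by rw [jensenCubic_succ, h]⟩
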